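/- arXiv:2508.13778 — 8 statements merged into one kernel-verified Lean document; each statement's English description precedes it below -/
import Mathlib

section
/- There exist constants c₁, c₂, c₃ > 0 and an integer ℓ₀ ≥ 2 such that for every integer ℓ ≥ ℓ₀, every κ > 0, every connected polymer X, every φ of class C² on a neighborhood of X̄⁽¹⁾, and every ψ of class C² on a neighborhood of X: G_κ(X, S_ℓφ + ψ) ≤ G_κ(X̄⁽¹⁾, φ) · g_κ(X, ψ). -/
open MeasureTheory

noncomputable section

/-- The plane, with its Euclidean structure. -/
abbrev E2 := EuclideanSpace ℝ (Fin 2)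

/-- The closed unit square (block) of the standard tessellation of `ℝ²` with lower-left
corner `p ∈ ℤ²`. -/
def unitSquare (p : ℤ × ℤ) : Set E2 :=
  {x | (p.1 : ℝ) ≤ x 0 ∧ x 0 ≤ (p.1 : ℝ) + 1 ∧ (p.2 : ℝ) ≤ x 1 ∧ x 1 ≤ (p.2 : ℝ) + 1}

/-- The polymer (finite union of closed unit squares) indexed by a finite set `S ⊆ ℤ²`. -/
def polymerOf (S : Finset (ℤ × ℤ)) : Set E2 := ⋃ p ∈ S, unitSquare p

/-- The closed side-`ℓ` square of the coarse tessellation indexed by `q ∈ ℤ²`. -/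
def bigSquare (ℓ : ℤ) (q : ℤ × ℤ) : Set E2 :=
  {x | ((ℓ * q.1 : ℤ) : ℝ) ≤ x 0 ∧ x 0 ≤ ((ℓ * (q.1 + 1) : ℤ) : ℝ) ∧
       ((ℓ * q.2 : ℤ) : ℝ) ≤ x 1 ∧ x 1 ≤ ((ℓ * (q.2 + 1) : ℤ) : ℝ)}

/-- `Q_ℓ(X)`: the union of all closed side-`ℓ` squares of the coarse tessellation
meeting `X`. -/
def Qset (ℓ : ℤ) (X : Set E2) : Set E2 :=
  ⋃ q ∈ {q : ℤ × ℤ | (bigSquare ℓ q ∩ X).Nonempty}, bigSquare ℓ q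

/-- `X̄⁽¹⁾ = ℓ⁻¹ Q_ℓ(X)`: the unit-scale polymer obtained by rescaling `Q_ℓ(X)`. -/
def closureBlock (ℓ : ℤ) (X : Set E2) : Set E2 :=
  (fun x : E2 => (ℓ : ℝ)⁻¹ • x) '' Qset ℓ X

/-- `‖∇ⁿf(x)‖`, the norm of the `n`-th derivative of `f` at `x`. -/
def dNorm (n : ℕ) (f : E2 → ℝ) (x : E2) : ℝ := ‖iteratedFDeriv ℝ n f x‖

/-- `‖∇ⁿf‖²_{B²_∞(A)} = Σ_{B ∈ B(A)} sup_B |∇ⁿf|²`, summed over the unit blocks of `A`. -/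
def blockSumSup (n : ℕ) (f : E2 → ℝ) (A : Set E2) : ℝ :=
  ∑' p : {p : ℤ × ℤ // unitSquare p ⊆ A}, ⨆ x ∈ unitSquare p.1, dNorm n f x ^ 2

/-- The large-field regulator
`G_κ(A, φ) = exp(κ⁻¹ (c₁(‖∇φ‖²_{L²(A)} + ‖∇²φ‖²_{B²_∞(A)}) + c₂ ∫_{∂A} |∇φ|² dH¹))`. -/
def Greg (c₁ c₂ κ : ℝ) (A : Set E2) (φ : E2 → ℝ) : ℝ :=
  Real.exp (κ⁻¹ *
    (c₁ * ((∫ x in A, dNorm 1 φ x ^ 2) + blockSumSup 2 φ A) +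
     c₂ * (∫ x in frontier A, dNorm 1 φ x ^ 2 ∂(μH[1]))))

/-- The auxiliary regulator `g_κ(A, ψ) = exp(κ⁻¹ c₃ Σ_{n=0}^{2} ‖∇ⁿψ‖²_{B²_∞(A)})`. -/
def greg (c₃ κ : ℝ) (A : Set E2) (ψ : E2 → ℝ) : ℝ :=
  Real.exp (κ⁻¹ * c₃ *
    (blockSumSup 0 ψ A + blockSumSup 1 ψ A + blockSumSup 2 ψ A))

section
open Set Filter Topology


/-! ### Coordinates on the plane -/

def mkE (z : ℝ × ℝ) : E2 := WithLp.toLp 2 ![z.1, z.2]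

lemma mkE_zero (z : ℝ × ℝ) : mkE z 0 = z.1 := rfl
lemma mkE_one (z : ℝ × ℝ) : mkE z 1 = z.2 := rfl

def e0 : E2 := mkE (1, 0)
def e1 : E2 := mkE (0, 1)

def mkL : (ℝ × ℝ) →L[ℝ] E2 :=
  (ContinuousLinearMap.fst ℝ ℝ ℝ).smulRight e0 + (ContinuousLinearMap.snd ℝ ℝ ℝ).smulRight e1

lemma mkL_apply (z : ℝ × ℝ) : mkL z = mkE z := by
  ext i
  fin_cases i <;> simp [mkL, e0, e1, mkE]

lemma mkE_eta (x : E2) : mkE (x 0, x 1) = x := by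
  ext i
  fin_cases i <;> simp [mkE]

lemma continuous_mkE : Continuous mkE := by
  have : mkE = mkL := by ext1 z; exact (mkL_apply z).symm
  rw [this]; exact mkL.continuous

def mkM : (ℝ × ℝ) ≃ᵐ E2 :=
  (MeasurableEquiv.finTwoArrow (α := ℝ)).symm.trans (MeasurableEquiv.toLp 2 (Fin 2 → ℝ))

lemma mkM_apply (z : ℝ × ℝ) : mkM z = mkE z := rfl

lemma mkM_mp : MeasurePreserving mkM volume volume :=
  ((volume_preserving_finTwoArrow ℝ).symm _).trans (PiLp.volume_preserving_toLp (Fin 2))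

def box (p : ℤ × ℤ) : Set (ℝ × ℝ) :=
  Icc (p.1 : ℝ) (p.1 + 1) ×ˢ Icc (p.2 : ℝ) (p.2 + 1)

lemma mem_box (p : ℤ × ℤ) (z : ℝ × ℝ) : z ∈ box p ↔ mkE z ∈ unitSquare p := by
  simp only [box, unitSquare, mkE_zero, mkE_one, mem_prod, mem_Icc, mem_ofPred_eq, and_assoc]

lemma unitSquare_eq_image (p : ℤ × ℤ) : unitSquare p = mkE '' box p := by
  ext x
  constructor
  · intro hx
    exact ⟨(x 0, x 1), by rw [mem_box, mkE_eta]; exact hx, mkE_eta x⟩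
  · rintro ⟨z, hz, rfl⟩
    exact (mem_box p z).1 hz

lemma isCompact_unitSquare (p : ℤ × ℤ) : IsCompact (unitSquare p) := by
  rw [unitSquare_eq_image]
  exact (isCompact_Icc.prod isCompact_Icc).image continuous_mkE

lemma isClosed_unitSquare (p : ℤ × ℤ) : IsClosed (unitSquare p) :=
  (isCompact_unitSquare p).isClosed

lemma measurableSet_unitSquare (p : ℤ × ℤ) : MeasurableSet (unitSquare p) :=
  (isClosed_unitSquare p).measurableSet

lemma preimage_unitSquare (p : ℤ × ℤ) : mkM ⁻¹' (unitSquare p) = box p := by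
  ext z; rw [mem_box]; rfl

lemma setIntegral_unitSquare (p : ℤ × ℤ) (f : E2 → ℝ) :
    ∫ x in unitSquare p, f x = ∫ z in box p, f (mkE z) := by
  rw [← preimage_unitSquare]
  exact (mkM_mp.setIntegral_preimage_emb mkM.measurableEmbedding f (unitSquare p)).symm

lemma volume_unitSquare (p : ℤ × ℤ) : volume (unitSquare p) = 1 := by
  rw [← mkM_mp.measure_preimage (measurableSet_unitSquare p).nullMeasurableSet,
    preimage_unitSquare, box, Measure.volume_eq_prod, Measure.prod_prod]
  simp

lemma convex_unitSquare (p : ℤ × ℤ) : Convex ℝ (unitSquare p) := by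
  have : unitSquare p = mkL '' box p := by
    rw [unitSquare_eq_image]; apply image_congr; intro z _; exact (mkL_apply z).symm
  rw [this]
  exact ((convex_Icc _ _).prod (convex_Icc _ _)).linear_image mkL.toLinearMap

lemma norm_sq_E2 (x : E2) : ‖x‖ ^ 2 = x 0 ^ 2 + x 1 ^ 2 := by
  rw [EuclideanSpace.norm_sq_eq]; simp

lemma norm_sub_sq_le (p : ℤ × ℤ) {x y : E2} (hx : x ∈ unitSquare p) (hy : y ∈ unitSquare p) :
    ‖x - y‖ ^ 2 ≤ 2 := by
  rw [norm_sq_E2]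
  obtain ⟨a, b, c, d⟩ := hx
  obtain ⟨a', b', c', d'⟩ := hy
  simp only [PiLp.sub_apply]
  have h1 : |x 0 - y 0| ≤ 1 := by rw [abs_le]; constructor <;> linarith
  have h2 : |x 1 - y 1| ≤ 1 := by rw [abs_le]; constructor <;> linarith
  have := (sq_le_one_iff_abs_le_one _).2 h1
  have := (sq_le_one_iff_abs_le_one _).2 h2
  linarith

lemma norm_sq_dual (L : E2 →L[ℝ] ℝ) : ‖L‖ ^ 2 = L e0 ^ 2 + L e1 ^ 2 := by
  obtain ⟨v, rfl⟩ := (InnerProductSpace.toDual ℝ E2).surjective L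
  rw [LinearIsometryEquiv.norm_map, norm_sq_E2]
  simp [InnerProductSpace.toDual_apply_apply, e0, e1, mkE, PiLp.inner_apply]

lemma norm_e0 : ‖e0‖ = 1 := by
  have h := norm_sq_E2 e0
  have h' : e0 0 ^ 2 + e0 1 ^ 2 = 1 := by simp [e0, mkE]
  rw [h'] at h
  exact (pow_eq_one_iff_of_nonneg (norm_nonneg _) two_ne_zero).1 h

lemma norm_e1 : ‖e1‖ = 1 := by
  have h := norm_sq_E2 e1
  have h' : e1 0 ^ 2 + e1 1 ^ 2 = 1 := by simp [e1, mkE]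
  rw [h'] at h
  exact (pow_eq_one_iff_of_nonneg (norm_nonneg _) two_ne_zero).1 h

/-! ### Polymers -/

lemma mem_polymerOf {S : Finset (ℤ × ℤ)} {x : E2} :
    x ∈ polymerOf S ↔ ∃ p ∈ S, x ∈ unitSquare p := by simp [polymerOf]

lemma isCompact_polymerOf (S : Finset (ℤ × ℤ)) : IsCompact (polymerOf S) :=
  S.isCompact_biUnion fun p _ => isCompact_unitSquare p

lemma unitSquare_subset_polymerOf {S : Finset (ℤ × ℤ)} {p : ℤ × ℤ} (hp : p ∈ S) :
    unitSquare p ⊆ polymerOf S := fun _ hx => mem_polymerOf.2 ⟨p, hp, hx⟩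

lemma unitSquare_subset_iff {S : Finset (ℤ × ℤ)} {p : ℤ × ℤ} :
    unitSquare p ⊆ polymerOf S ↔ p ∈ S := by
  refine ⟨fun h => ?_, unitSquare_subset_polymerOf⟩
  have hc : mkE ((p.1 : ℝ) + 1 / 2, (p.2 : ℝ) + 1 / 2) ∈ unitSquare p := by
    simp only [unitSquare, mem_ofPred_eq, mkE_zero, mkE_one]
    refine ⟨?_, ?_, ?_, ?_⟩ <;> linarith
  obtain ⟨q, hq, h1, h2, h3, h4⟩ := mem_polymerOf.1 (h hc)
  simp only [mkE_zero, mkE_one] at h1 h2 h3 h4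
  have a1 : (q.1 : ℝ) < p.1 + 1 := by linarith
  have a2 : (p.1 : ℝ) < q.1 + 1 := by linarith
  have a3 : (q.2 : ℝ) < p.2 + 1 := by linarith
  have a4 : (p.2 : ℝ) < q.2 + 1 := by linarith
  norm_cast at a1 a2 a3 a4
  have : p = q := Prod.ext (by omega) (by omega)
  rwa [this]

lemma blockSumSup_polymerOf (n : ℕ) (f : E2 → ℝ) (S : Finset (ℤ × ℤ)) :
    blockSumSup n f (polymerOf S) = ∑ p ∈ S, ⨆ x ∈ unitSquare p, dNorm n f x ^ 2 := by
  unfold blockSumSup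
  have h : {p : ℤ × ℤ | unitSquare p ⊆ polymerOf S} = (S : Set (ℤ × ℤ)) := by
    ext p; simp [unitSquare_subset_iff]
  have := tsum_congr_set_coe (fun p => ⨆ x ∈ unitSquare p, dNorm n f x ^ 2) h
  exact this.trans (S.tsum_subtype' (fun p => ⨆ x ∈ unitSquare p, dNorm n f x ^ 2))

lemma aedisjoint_unitSquare {p q : ℤ × ℤ} (h : p ≠ q) :
    AEDisjoint volume (unitSquare p) (unitSquare q) := by
  rw [AEDisjoint, ← mkM_mp.measure_preimage ((measurableSet_unitSquare p).inter
    (measurableSet_unitSquare q)).nullMeasurableSet, preimage_inter, preimage_unitSquare,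
    preimage_unitSquare, box, box, prod_inter_prod, Measure.volume_eq_prod, Measure.prod_prod]
  have key : ∀ a b : ℤ, a ≠ b → 
      volume (Icc (a : ℝ) (a + 1) ∩ Icc (b : ℝ) (b + 1)) = 0 := by
    intro a b hab
    rw [Icc_inter_Icc, Real.volume_Icc, ENNReal.ofReal_eq_zero]
    rcases lt_or_gt_of_ne hab with h | h
    · have : (a : ℝ) + 1 ≤ b := by exact_mod_cast h
      have := le_max_right (a : ℝ) b
      have := min_le_left ((a : ℝ) + 1) (b + 1)
      linarith
    · have : (b : ℝ) + 1 ≤ a := by exact_mod_cast h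
      have := le_max_left (a : ℝ) b
      have := min_le_right ((a : ℝ) + 1) (b + 1)
      linarith
  by_cases h1 : p.1 = q.1
  · rw [key p.2 q.2 (fun h2 => h (Prod.ext h1 h2)), mul_zero]
  · rw [key p.1 q.1 h1, zero_mul]

lemma setIntegral_polymerOf (S : Finset (ℤ × ℤ)) (f : E2 → ℝ)
    (hf : IntegrableOn f (polymerOf S)) :
    ∫ x in polymerOf S, f x = ∑ p ∈ S, ∫ x in unitSquare p, f x := by
  have h : polymerOf S = ⋃ p : S, unitSquare p := by
    simp [polymerOf, iUnion_subtype]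
  rw [h] at hf ⊢
  rw [integral_iUnion_ae (fun i => (measurableSet_unitSquare _).nullMeasurableSet) _ hf]
  · rw [tsum_fintype]
    exact S.sum_coe_sort (fun p => ∫ x in unitSquare p, f x)
  · intro a b hab
    exact aedisjoint_unitSquare (fun h => hab (Subtype.ext h))

/-! ### Suprema over blocks -/

lemma bs_nonneg (n : ℕ) (f : E2 → ℝ) (p : ℤ × ℤ) :
    0 ≤ ⨆ x ∈ unitSquare p, dNorm n f x ^ 2 :=
  Real.iSup_nonneg fun _ => Real.iSup_nonneg fun _ => sq_nonneg _

lemma bs_le {n : ℕ} {f : E2 → ℝ} {p : ℤ × ℤ} {C : ℝ} (hC : 0 ≤ C)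
    (h : ∀ x ∈ unitSquare p, dNorm n f x ^ 2 ≤ C) :
    ⨆ x ∈ unitSquare p, dNorm n f x ^ 2 ≤ C :=
  Real.iSup_le (fun x => Real.iSup_le (fun hx => h x hx) hC) hC

lemma le_bs {n : ℕ} {f : E2 → ℝ} {p : ℤ × ℤ}
    (h : ContinuousOn (dNorm n f) (unitSquare p)) {x : E2} (hx : x ∈ unitSquare p) :
    dNorm n f x ^ 2 ≤ ⨆ x ∈ unitSquare p, dNorm n f x ^ 2 := by
  obtain ⟨C, hC⟩ := (isCompact_unitSquare p).bddAbove_image (h.pow 2)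
  have hC' : ∀ y ∈ unitSquare p, dNorm n f y ^ 2 ≤ C := fun y hy => hC ⟨y, hy, rfl⟩
  have hC0 : 0 ≤ C := (sq_nonneg _).trans (hC' x hx)
  have hb : BddAbove (range fun y => ⨆ (_ : y ∈ unitSquare p), dNorm n f y ^ 2) := by
    refine ⟨C, ?_⟩
    rintro _ ⟨y, rfl⟩
    exact Real.iSup_le (fun hy => hC' y hy) hC0
  have := le_ciSup hb x
  simpa [hx] using this

lemma dNorm_zero (f : E2 → ℝ) (x : E2) : dNorm 0 f x = |f x| := by
  simp [dNorm]

lemma dNorm_one (f : E2 → ℝ) (x : E2) : dNorm 1 f x = ‖fderiv ℝ f x‖ := by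
  rw [dNorm, norm_iteratedFDeriv_one]

lemma dNorm_two (f : E2 → ℝ) (x : E2) : dNorm 2 f x = ‖fderiv ℝ (fderiv ℝ f) x‖ := by
  rw [dNorm, ← norm_iteratedFDeriv_fderiv, norm_iteratedFDeriv_one]

lemma cont_dNorm {f : E2 → ℝ} {U : Set E2} (hU : IsOpen U) (hf : ContDiffOn ℝ 2 f U) {n : ℕ}
    (hn : n ≤ 2) : ContinuousOn (dNorm n f) U := by
  have h := hf.continuousOn_iteratedFDerivWithin (m := n) (by exact_mod_cast hn) hU.uniqueDiffOn
  refine h.norm.congr ?_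
  intro x hx
  simp only [dNorm]
  rw [iteratedFDerivWithin_of_isOpen n hU hx]

/-! ### Analysis on a single block -/

lemma contDiffOn_fderiv {f : E2 → ℝ} {U : Set E2} (hU : IsOpen U) (hf : ContDiffOn ℝ 2 f U) :
    ContDiffOn ℝ 1 (fderiv ℝ f) U :=
  hf.fderiv_of_isOpen hU (by norm_num)

lemma diffAt {f : E2 → ℝ} {U : Set E2} (hU : IsOpen U) (hf : ContDiffOn ℝ 2 f U) {x : E2}
    (hx : x ∈ U) : DifferentiableAt ℝ f x :=
  (hf.differentiableOn two_ne_zero).differentiableAt (hU.mem_nhds hx)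

lemma diffAt_fderiv {f : E2 → ℝ} {U : Set E2} (hU : IsOpen U) (hf : ContDiffOn ℝ 2 f U) {x : E2}
    (hx : x ∈ U) : DifferentiableAt ℝ (fderiv ℝ f) x :=
  ((contDiffOn_fderiv hU hf).differentiableOn one_ne_zero).differentiableAt (hU.mem_nhds hx)

lemma cont_fderiv {f : E2 → ℝ} {U : Set E2} (hU : IsOpen U) (hf : ContDiffOn ℝ 2 f U) :
    ContinuousOn (fderiv ℝ f) U := (contDiffOn_fderiv hU hf).continuousOn

lemma cont_fderiv2 {f : E2 → ℝ} {U : Set E2} (hU : IsOpen U) (hf : ContDiffOn ℝ 2 f U) :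
    ContinuousOn (fderiv ℝ (fderiv ℝ f)) U :=
  (contDiffOn_fderiv hU hf).continuousOn_fderiv_of_isOpen hU le_rfl

lemma intOn_const (p : ℤ × ℤ) (c : ℝ) : IntegrableOn (fun _ : E2 => c) (unitSquare p) :=
  integrableOn_const (by rw [volume_unitSquare]; simp)

lemma integral_const_unitSquare (p : ℤ × ℤ) (c : ℝ) : ∫ _ in unitSquare p, c = c := by
  rw [setIntegral_const, measureReal_def, volume_unitSquare]; simp

/-- An abbreviation for the block suprema. -/
def bs (n : ℕ) (f : E2 → ℝ) (p : ℤ × ℤ) : ℝ := ⨆ x ∈ unitSquare p, dNorm n f x ^ 2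

lemma sup_grad_le {F : E2 → ℝ} {U : Set E2} (hU : IsOpen U) (hF : ContDiffOn ℝ 2 F U)
    {p : ℤ × ℤ} (hp : unitSquare p ⊆ U) :
    bs 1 F p ≤ 2 * (∫ y in unitSquare p, dNorm 1 F y ^ 2) + 4 * bs 2 F p := by
  have hb0 : 0 ≤ bs 2 F p := bs_nonneg 2 F p
  have hi0 : 0 ≤ ∫ y in unitSquare p, dNorm 1 F y ^ 2 := integral_nonneg fun _ => sq_nonneg _
  refine bs_le (by positivity) fun x hx => ?_
  have hint : IntegrableOn (fun y => dNorm 1 F y ^ 2) (unitSquare p) :=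
    (((cont_dNorm hU hF (by norm_num)).mono hp).pow 2).integrableOn_compact
      (isCompact_unitSquare p)
  have hbd : ∀ z ∈ unitSquare p, ‖fderiv ℝ (fderiv ℝ F) z‖ ≤ √(bs 2 F p) := by
    intro z hz
    have := le_bs ((cont_dNorm hU hF le_rfl).mono hp) hz
    rw [dNorm_two] at this
    exact Real.le_sqrt_of_sq_le this
  have hpt : ∀ y ∈ unitSquare p, dNorm 1 F x ^ 2 ≤ 2 * dNorm 1 F y ^ 2 + 4 * bs 2 F p := by
    intro y hy
    have h := (convex_unitSquare p).norm_image_sub_le_of_norm_fderiv_le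
      (fun z hz => diffAt_fderiv hU hF (hp hz)) hbd hy hx
    have h2 := norm_sub_sq_le p hx hy
    rw [dNorm_one, dNorm_one]
    have h3 : ‖fderiv ℝ F x‖ ≤ ‖fderiv ℝ F y‖ + ‖fderiv ℝ F x - fderiv ℝ F y‖ :=
      norm_le_norm_add_norm_sub' _ _
    have h4 : ‖fderiv ℝ F x - fderiv ℝ F y‖ ^ 2 ≤ 2 * bs 2 F p := by
      calc _ ≤ (√(bs 2 F p) * ‖x - y‖) ^ 2 := by gcongr
        _ = bs 2 F p * ‖x - y‖ ^ 2 := by rw [mul_pow, Real.sq_sqrt hb0]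
        _ ≤ bs 2 F p * 2 := by gcongr
        _ = _ := by ring
    have h5 : ‖fderiv ℝ F x‖ ^ 2 ≤ (‖fderiv ℝ F y‖ + ‖fderiv ℝ F x - fderiv ℝ F y‖) ^ 2 := by
      gcongr
    nlinarith [sq_nonneg (‖fderiv ℝ F y‖ - ‖fderiv ℝ F x - fderiv ℝ F y‖)]
  calc dNorm 1 F x ^ 2 = ∫ _ in unitSquare p, dNorm 1 F x ^ 2 :=
        (integral_const_unitSquare p _).symm
    _ ≤ ∫ y in unitSquare p, (2 * dNorm 1 F y ^ 2 + 4 * bs 2 F p) :=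
        setIntegral_mono_on (intOn_const p _)
          (Integrable.fun_add (f := fun y => 2 * dNorm 1 F y ^ 2) (g := fun _ => 4 * bs 2 F p)
            (hint.const_mul 2) (intOn_const p _))
          (measurableSet_unitSquare p) hpt
    _ = _ := by
        rw [integral_add (hint.const_mul 2) (intOn_const p _),
          integral_const_unitSquare, integral_const_mul]

def Vf (F ψ : E2 → ℝ) (p : ℤ × ℤ) : ℝ :=
  ∫ y in (p.2 : ℝ)..(p.2 + 1), ψ (mkE (p.1, y)) * fderiv ℝ F (mkE (p.1, y)) e0

def Hf (F ψ : E2 → ℝ) (p : ℤ × ℤ) : ℝ :=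
  ∫ x in (p.1 : ℝ)..(p.1 + 1), ψ (mkE (x, p.2)) * fderiv ℝ F (mkE (x, p.2)) e1

def lap (F : E2 → ℝ) (x : E2) : ℝ :=
  fderiv ℝ (fderiv ℝ F) x e0 e0 + fderiv ℝ (fderiv ℝ F) x e1 e1

def crs (F ψ : E2 → ℝ) (x : E2) : ℝ :=
  fderiv ℝ F x e0 * fderiv ℝ ψ x e0 + fderiv ℝ F x e1 * fderiv ℝ ψ x e1

lemma cont_lap {F : E2 → ℝ} {U : Set E2} (hU : IsOpen U) (hF : ContDiffOn ℝ 2 F U) :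
    ContinuousOn (lap F) U := by
  have := cont_fderiv2 hU hF
  unfold lap
  fun_prop

lemma cont_crs {F ψ : E2 → ℝ} {U : Set E2} (hU : IsOpen U) (hF : ContDiffOn ℝ 2 F U)
    (hψ : ContDiffOn ℝ 2 ψ U) :
    ContinuousOn (crs F ψ) U := by
  have := cont_fderiv hU hF
  have := cont_fderiv hU hψ
  unfold crs
  fun_prop

lemma hasFDerivAt_field {F ψ : E2 → ℝ} {U : Set E2} (hU : IsOpen U) (hF : ContDiffOn ℝ 2 F U)
    (hψ : ContDiffOn ℝ 2 ψ U) (e : E2) {z : ℝ × ℝ} (hz : mkE z ∈ U) :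
    HasFDerivAt (fun z : ℝ × ℝ => ψ (mkE z) * fderiv ℝ F (mkE z) e)
      ((ψ (mkE z) • (fderiv ℝ (fderiv ℝ F) (mkE z)).flip e
        + (fderiv ℝ F (mkE z) e) • fderiv ℝ ψ (mkE z)).comp mkL) z := by
  have h1 : HasFDerivAt (fun x : E2 => ψ x * fderiv ℝ F x e)
      (ψ (mkE z) • (fderiv ℝ (fderiv ℝ F) (mkE z)).flip e
        + (fderiv ℝ F (mkE z) e) • fderiv ℝ ψ (mkE z)) (mkL z) := by
    rw [mkL_apply]
    have a := (diffAt hU hψ hz).hasFDerivAt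
    have b := (diffAt_fderiv hU hF hz).hasFDerivAt
    have c := b.clm_apply (hasFDerivAt_const e (mkE z))
    refine (a.fun_mul c).congr_fderiv ?_
    simp
  have h2 := h1.comp z mkL.hasFDerivAt
  have h3 : (fun z : ℝ × ℝ => ψ (mkE z) * fderiv ℝ F (mkE z) e) =
      (fun x : E2 => ψ x * fderiv ℝ F x e) ∘ mkL := by
    funext w
    simp [mkL_apply]
  rw [h3]
  exact h2

lemma block_ibp {F ψ : E2 → ℝ} {U : Set E2} (hU : IsOpen U) (hF : ContDiffOn ℝ 2 F U)
    (hψ : ContDiffOn ℝ 2 ψ U) {p : ℤ × ℤ} (hp : unitSquare p ⊆ U) :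
    ∫ x in unitSquare p, (crs F ψ x + ψ x * lap F x) =
      Vf F ψ (p + (1, 0)) - Vf F ψ p + (Hf F ψ (p + (0, 1)) - Hf F ψ p) := by
  have hbox : ∀ z ∈ box p, mkE z ∈ U := fun z hz => hp ((mem_box p z).1 hz)
  have hu1 : uIcc (p.1 : ℝ) (p.1 + 1) = Icc (p.1 : ℝ) (p.1 + 1) := uIcc_of_le (by linarith)
  have hu2 : uIcc (p.2 : ℝ) (p.2 + 1) = Icc (p.2 : ℝ) (p.2 + 1) := uIcc_of_le (by linarith)
  have hm1 : min (p.1 : ℝ) (p.1 + 1) = p.1 := min_eq_left (by linarith)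
  have hm2 : min (p.2 : ℝ) (p.2 + 1) = p.2 := min_eq_left (by linarith)
  have hM1 : max (p.1 : ℝ) (p.1 + 1) = p.1 + 1 := max_eq_right (by linarith)
  have hM2 : max (p.2 : ℝ) (p.2 + 1) = p.2 + 1 := max_eq_right (by linarith)
  have hfield := fun (e : E2) (z : ℝ × ℝ) (hz : z ∈ box p) =>
    hasFDerivAt_field hU hF hψ e (hbox z hz)
  have hdiv : ∀ z : ℝ × ℝ,
      ((ψ (mkE z) • (fderiv ℝ (fderiv ℝ F) (mkE z)).flip e0
        + (fderiv ℝ F (mkE z) e0) • fderiv ℝ ψ (mkE z)).comp mkL) (1, 0) +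
      ((ψ (mkE z) • (fderiv ℝ (fderiv ℝ F) (mkE z)).flip e1
        + (fderiv ℝ F (mkE z) e1) • fderiv ℝ ψ (mkE z)).comp mkL) (0, 1)
      = crs F ψ (mkE z) + ψ (mkE z) * lap F (mkE z) := by
    intro z
    simp only [ContinuousLinearMap.comp_apply, mkL_apply, add_apply,
      smul_apply,
      ContinuousLinearMap.flip_apply, smul_eq_mul, crs, lap]
    change ψ (mkE z) * fderiv ℝ (fderiv ℝ F) (mkE z) e0 e0 + _ * fderiv ℝ ψ (mkE z) e0 +
      (ψ (mkE z) * fderiv ℝ (fderiv ℝ F) (mkE z) e1 e1 + _ * fderiv ℝ ψ (mkE z) e1) = _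
    ring
  have hcont : ContinuousOn (fun z => crs F ψ (mkE z) + ψ (mkE z) * lap F (mkE z)) (box p) :=
    ((cont_crs hU hF hψ).add (hψ.continuousOn.mul (cont_lap hU hF))).comp
      continuous_mkE.continuousOn hbox
  have hint : IntegrableOn (fun z => crs F ψ (mkE z) + ψ (mkE z) * lap F (mkE z)) (box p) :=
    hcont.integrableOn_compact (isCompact_Icc.prod isCompact_Icc)
  have key := integral2_divergence_prod_of_hasFDerivAt_off_countable
    (fun z => ψ (mkE z) * fderiv ℝ F (mkE z) e0) (fun z => ψ (mkE z) * fderiv ℝ F (mkE z) e1)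
    (fun z => (ψ (mkE z) • (fderiv ℝ (fderiv ℝ F) (mkE z)).flip e0
        + (fderiv ℝ F (mkE z) e0) • fderiv ℝ ψ (mkE z)).comp mkL)
    (fun z => (ψ (mkE z) • (fderiv ℝ (fderiv ℝ F) (mkE z)).flip e1
        + (fderiv ℝ F (mkE z) e1) • fderiv ℝ ψ (mkE z)).comp mkL)
    (p.1 : ℝ) (p.2 : ℝ) (p.1 + 1) (p.2 + 1) ∅ countable_empty
    (by rw [hu1, hu2]; exact fun z hz => (hfield e0 z hz).continuousAt.continuousWithinAt)
    (by rw [hu1, hu2]; exact fun z hz => (hfield e1 z hz).continuousAt.continuousWithinAt)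
    (by
      rw [hm1, hm2, hM1, hM2]
      rintro z ⟨⟨hz1, hz2⟩, -⟩
      exact hfield e0 z ⟨Ioo_subset_Icc_self hz1, Ioo_subset_Icc_self hz2⟩)
    (by
      rw [hm1, hm2, hM1, hM2]
      rintro z ⟨⟨hz1, hz2⟩, -⟩
      exact hfield e1 z ⟨Ioo_subset_Icc_self hz1, Ioo_subset_Icc_self hz2⟩)
    (by
      simp only [hdiv]
      rw [hu1, hu2]; exact hint)
  simp only [hdiv] at key
  rw [setIntegral_unitSquare]
  rw [box, Measure.volume_eq_prod, setIntegral_prod _ hint]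
  rw [intervalIntegral.integral_of_le (by linarith), ← integral_Icc_eq_integral_Ioc] at key
  have hin : ∀ x : ℝ, ∫ y in Icc (p.2 : ℝ) (p.2 + 1),
      (crs F ψ (mkE (x, y)) + ψ (mkE (x, y)) * lap F (mkE (x, y))) =
      ∫ y in (p.2 : ℝ)..(p.2 + 1), (crs F ψ (mkE (x, y)) + ψ (mkE (x, y)) * lap F (mkE (x, y))) := by
    intro x
    rw [intervalIntegral.integral_of_le (by linarith), ← integral_Icc_eq_integral_Ioc]
  simp only [hin]
  rw [key]
  simp only [Vf, Hf, Prod.fst_add, Prod.snd_add, Int.cast_add, Int.cast_one, add_zero]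
  ring

lemma Vf_le {F ψ : E2 → ℝ} {p q : ℤ × ℤ} {A B : ℝ} (hq : q = p)
    (hA : ∀ x ∈ unitSquare p, x 0 = p.1 → dNorm 1 F x ^ 2 ≤ A)
    (hB : ∀ x ∈ unitSquare p, x 0 = p.1 → dNorm 0 ψ x ^ 2 ≤ B) :
    |Vf F ψ q| ≤ A / 32 + 8 * B := by
  subst hq
  have := intervalIntegral.norm_integral_le_of_norm_le_const (a := (q.2 : ℝ)) (b := q.2 + 1)
    (f := fun y => ψ (mkE (q.1, y)) * fderiv ℝ F (mkE (q.1, y)) e0) (C := A / 32 + 8 * B) ?_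
  · simpa [Vf] using this
  · intro y hy
    rw [uIoc_of_le (by linarith)] at hy
    have hm : mkE ((q.1 : ℝ), y) ∈ unitSquare q := by
      rw [← mem_box]; exact ⟨⟨le_rfl, by simp⟩, Ioc_subset_Icc_self hy⟩
    have h1 := hA _ hm rfl
    have h2 := hB _ hm rfl
    rw [dNorm_one] at h1
    rw [dNorm_zero] at h2
    have h3 : |fderiv ℝ F (mkE ((q.1 : ℝ), y)) e0| ≤ ‖fderiv ℝ F (mkE ((q.1 : ℝ), y))‖ := by
      have := (fderiv ℝ F (mkE ((q.1 : ℝ), y))).le_opNorm e0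
      rwa [norm_e0, mul_one] at this
    rw [norm_mul, Real.norm_eq_abs, Real.norm_eq_abs]
    have h4 : |ψ (mkE ((q.1 : ℝ), y))| * |fderiv ℝ F (mkE ((q.1 : ℝ), y)) e0| ≤
      |ψ (mkE ((q.1 : ℝ), y))| * ‖fderiv ℝ F (mkE ((q.1 : ℝ), y))‖ := by gcongr
    nlinarith [sq_nonneg (16 * |ψ (mkE ((q.1 : ℝ), y))| - ‖fderiv ℝ F (mkE ((q.1 : ℝ), y))‖)]

lemma Hf_le {F ψ : E2 → ℝ} {p q : ℤ × ℤ} {A B : ℝ} (hq : q = p)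
    (hA : ∀ x ∈ unitSquare p, x 1 = p.2 → dNorm 1 F x ^ 2 ≤ A)
    (hB : ∀ x ∈ unitSquare p, x 1 = p.2 → dNorm 0 ψ x ^ 2 ≤ B) :
    |Hf F ψ q| ≤ A / 32 + 8 * B := by
  subst hq
  have := intervalIntegral.norm_integral_le_of_norm_le_const (a := (q.1 : ℝ)) (b := q.1 + 1)
    (f := fun y => ψ (mkE (y, q.2)) * fderiv ℝ F (mkE (y, q.2)) e1) (C := A / 32 + 8 * B) ?_
  · simpa [Hf] using this
  · intro y hy
    rw [uIoc_of_le (by linarith)] at hy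
    have hm : mkE (y, (q.2 : ℝ)) ∈ unitSquare q := by
      rw [← mem_box]; exact ⟨Ioc_subset_Icc_self hy, ⟨le_rfl, by simp⟩⟩
    have h1 := hA _ hm rfl
    have h2 := hB _ hm rfl
    rw [dNorm_one] at h1
    rw [dNorm_zero] at h2
    have h3 : |fderiv ℝ F (mkE (y, (q.2 : ℝ))) e1| ≤ ‖fderiv ℝ F (mkE (y, (q.2 : ℝ)))‖ := by
      have := (fderiv ℝ F (mkE (y, (q.2 : ℝ)))).le_opNorm e1
      rwa [norm_e1, mul_one] at this
    rw [norm_mul, Real.norm_eq_abs, Real.norm_eq_abs]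
    have h4 : |ψ (mkE (y, (q.2 : ℝ)))| * |fderiv ℝ F (mkE (y, (q.2 : ℝ))) e1| ≤
      |ψ (mkE (y, (q.2 : ℝ)))| * ‖fderiv ℝ F (mkE (y, (q.2 : ℝ)))‖ := by gcongr
    nlinarith [sq_nonneg (16 * |ψ (mkE (y, (q.2 : ℝ)))| - ‖fderiv ℝ F (mkE (y, (q.2 : ℝ)))‖)]

lemma abs_lap_le (F : E2 → ℝ) (x : E2) : |lap F x| ≤ 2 * dNorm 2 F x := by
  rw [dNorm_two]
  have h : ∀ e : E2, ‖e‖ = 1 → |fderiv ℝ (fderiv ℝ F) x e e| ≤ ‖fderiv ℝ (fderiv ℝ F) x‖ := by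
    intro e he
    have := (fderiv ℝ (fderiv ℝ F) x).le_opNorm₂ e e
    rwa [he, mul_one, mul_one] at this
  have h0 := h e0 norm_e0
  have h1 := h e1 norm_e1
  have := abs_add_le (fderiv ℝ (fderiv ℝ F) x e0 e0) (fderiv ℝ (fderiv ℝ F) x e1 e1)
  unfold lap
  linarith

lemma block_main {F ψ : E2 → ℝ} {U : Set E2} (hU : IsOpen U) (hF : ContDiffOn ℝ 2 F U)
    (hψ : ContDiffOn ℝ 2 ψ U) {p : ℤ × ℤ} (hp : unitSquare p ⊆ U) :
    ∫ x in unitSquare p, dNorm 1 (fun x => F x + ψ x) x ^ 2 ≤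
      (∫ x in unitSquare p, dNorm 1 F x ^ 2) + bs 1 ψ p + 2 * bs 0 ψ p + 2 * bs 2 F p +
      2 * (Vf F ψ (p + (1, 0)) - Vf F ψ p + (Hf F ψ (p + (0, 1)) - Hf F ψ p)) := by
  have hintF : IntegrableOn (fun y => dNorm 1 F y ^ 2) (unitSquare p) :=
    (((cont_dNorm hU hF (by norm_num)).mono hp).pow 2).integrableOn_compact
      (isCompact_unitSquare p)
  have hcC : ContinuousOn (fun x => crs F ψ x + ψ x * lap F x) (unitSquare p) :=
    ((cont_crs hU hF hψ).add (hψ.continuousOn.mul (cont_lap hU hF))).mono hp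
  have hintC := hcC.integrableOn_compact (μ := volume) (isCompact_unitSquare p)
  have hψ' := hψ
  have hsum : ContDiffOn ℝ 2 (fun x => F x + ψ x) U := hF.add hψ
  have hintS : IntegrableOn (fun y => dNorm 1 (fun x => F x + ψ x) y ^ 2) (unitSquare p) :=
    (((cont_dNorm hU hsum (by norm_num)).mono hp).pow 2).integrableOn_compact
      (isCompact_unitSquare p)
  rw [← block_ibp hU hF hψ hp]
  set K := bs 1 ψ p + 2 * bs 0 ψ p + 2 * bs 2 F p with hK
  have hpt : ∀ x ∈ unitSquare p, dNorm 1 (fun x => F x + ψ x) x ^ 2 ≤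
      dNorm 1 F x ^ 2 + K + 2 * (crs F ψ x + ψ x * lap F x) := by
    intro x hx
    have h0 := le_bs ((cont_dNorm hU hψ (n := 0) (by norm_num)).mono hp) hx
    have h1 := le_bs ((cont_dNorm hU hψ (n := 1) (by norm_num)).mono hp) hx
    have h2 := le_bs ((cont_dNorm hU hF (n := 2) (by norm_num)).mono hp) hx
    change _ ≤ bs _ _ _ at h0 h1 h2
    have hl := abs_lap_le F x
    rw [dNorm_zero] at h0
    have e : dNorm 1 (fun x => F x + ψ x) x ^ 2 =
        dNorm 1 F x ^ 2 + dNorm 1 ψ x ^ 2 + 2 * crs F ψ x := by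
      simp only [dNorm_one]
      rw [fderiv_fun_add (diffAt hU hF (hp hx)) (diffAt hU hψ (hp hx)), norm_sq_dual,
        norm_sq_dual, norm_sq_dual, crs]
      simp only [add_apply]
      ring
    rw [e]
    have h5 : |ψ x * lap F x| ≤ |ψ x| * (2 * dNorm 2 F x) := by
      rw [abs_mul]; gcongr
    have h6 := neg_abs_le (ψ x * lap F x)
    nlinarith [sq_nonneg (|ψ x| - dNorm 2 F x)]
  have hA : IntegrableOn (fun x => dNorm 1 F x ^ 2 + K) (unitSquare p) :=
    Integrable.add (f := fun y => dNorm 1 F y ^ 2) (g := fun _ => K) hintF (intOn_const p _)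
  have hB : IntegrableOn (fun x => 2 * (crs F ψ x + ψ x * lap F x)) (unitSquare p) :=
    hintC.const_mul 2
  calc _ ≤ ∫ x in unitSquare p, (dNorm 1 F x ^ 2 + K + 2 * (crs F ψ x + ψ x * lap F x)) :=
        setIntegral_mono_on hintS
          (Integrable.fun_add hA hB)
          (measurableSet_unitSquare p) hpt
    _ = _ := by
        rw [integral_add hA hB,
          integral_add hintF (intOn_const p _),
          integral_const_unitSquare, integral_const_mul, hK]
        ring

lemma bs2_add_le {F ψ : E2 → ℝ} {U : Set E2} (hU : IsOpen U) (hF : ContDiffOn ℝ 2 F U)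
    (hψ : ContDiffOn ℝ 2 ψ U) {p : ℤ × ℤ} (hp : unitSquare p ⊆ U) :
    bs 2 (fun x => F x + ψ x) p ≤ 2 * bs 2 F p + 2 * bs 2 ψ p := by
  have hF0 : 0 ≤ bs 2 F p := bs_nonneg 2 F p
  have hψ0 : 0 ≤ bs 2 ψ p := bs_nonneg 2 ψ p
  refine bs_le (by positivity) fun x hx => ?_
  have h1 := le_bs ((cont_dNorm hU hψ (n := 2) (by norm_num)).mono hp) hx
  have h2 := le_bs ((cont_dNorm hU hF (n := 2) (by norm_num)).mono hp) hx
  change _ ≤ bs _ _ _ at h1 h2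
  have hle : dNorm 2 (fun x => F x + ψ x) x ≤ dNorm 2 F x + dNorm 2 ψ x := by
    simp only [dNorm]
    have := iteratedFDeriv_add_apply (𝕜 := ℝ) (i := 2) (f := F) (g := ψ) (x := x)
      (hF.contDiffAt (hU.mem_nhds (hp hx))) (hψ.contDiffAt (hU.mem_nhds (hp hx)))
    have h3 : iteratedFDeriv ℝ 2 (fun x => F x + ψ x) x =
      iteratedFDeriv ℝ 2 F x + iteratedFDeriv ℝ 2 ψ x := this
    rw [h3]
    exact norm_add_le _ _
  have hnn : 0 ≤ dNorm 2 (fun x => F x + ψ x) x := norm_nonneg _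
  have : dNorm 2 (fun x => F x + ψ x) x ^ 2 ≤ (dNorm 2 F x + dNorm 2 ψ x) ^ 2 := by gcongr
  nlinarith [sq_nonneg (dNorm 2 F x - dNorm 2 ψ x)]

lemma grad_add_sq_le {F ψ : E2 → ℝ} {U : Set E2} (hU : IsOpen U) (hF : ContDiffOn ℝ 2 F U)
    (hψ : ContDiffOn ℝ 2 ψ U) {x : E2} (hx : x ∈ U) :
    dNorm 1 (fun x => F x + ψ x) x ^ 2 ≤ 2 * dNorm 1 F x ^ 2 + 2 * dNorm 1 ψ x ^ 2 := by
  simp only [dNorm_one]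
  rw [fderiv_fun_add (diffAt hU hF hx) (diffAt hU hψ hx)]
  have h := norm_add_le (fderiv ℝ F x) (fderiv ℝ ψ x)
  have : ‖fderiv ℝ F x + fderiv ℝ ψ x‖ ^ 2 ≤ (‖fderiv ℝ F x‖ + ‖fderiv ℝ ψ x‖) ^ 2 := by gcongr
  nlinarith [sq_nonneg (‖fderiv ℝ F x‖ - ‖fderiv ℝ ψ x‖)]

/-! ### The boundary of a polymer -/

def dirs : Finset (ℤ × ℤ) := {(1, 0), (-1, 0), (0, 1), (0, -1)}

/-- Blocks of `S` whose neighbour in direction `d` is outside `S`. -/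
def bdS (S : Finset (ℤ × ℤ)) (d : ℤ × ℤ) : Finset (ℤ × ℤ) := {p ∈ S | p + d ∉ S}

/-- Blocks outside of `S` sharing an edge with a block in `S`. -/
def nbS (S : Finset (ℤ × ℤ)) : Finset (ℤ × ℤ) :=
  dirs.biUnion fun d => (bdS S d).image (· + d)

lemma mem_nbS {S : Finset (ℤ × ℤ)} {d p : ℤ × ℤ} (hd : d ∈ dirs) (hp : p ∈ bdS S d) :
    p + d ∈ nbS S := by
  simp only [nbS, Finset.mem_biUnion, Finset.mem_image]
  exact ⟨d, hd, p, hp, rfl⟩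

lemma sum_nbS_le (S : Finset (ℤ × ℤ)) (a : ℤ × ℤ → ℝ) (ha : ∀ p, 0 ≤ a p) :
    ∑ d ∈ dirs, ∑ p ∈ bdS S d, a (p + d) ≤ 4 * ∑ p ∈ nbS S, a p := by
  have h : ∀ d ∈ dirs, ∑ p ∈ bdS S d, a (p + d) ≤ ∑ p ∈ nbS S, a p := by
    intro d hd
    rw [← Finset.sum_image (f := a) (g := (· + d)) (s := bdS S d)
      (fun x _ y _ h => add_right_cancel h)]
    refine Finset.sum_le_sum_of_subset_of_nonneg ?_ (fun _ _ _ => ha _)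
    intro q hq
    obtain ⟨p, hp, rfl⟩ := Finset.mem_image.1 hq
    exact mem_nbS hd hp
  have := Finset.sum_le_card_nsmul dirs _ _ h
  have hc : dirs.card = 4 := by decide
  rw [hc] at this
  simpa using this

lemma sum_bdS_le (S : Finset (ℤ × ℤ)) (a : ℤ × ℤ → ℝ) (ha : ∀ p, 0 ≤ a p) :
    ∑ d ∈ dirs, ∑ p ∈ bdS S d, a p ≤ 4 * ∑ p ∈ S, a p := by
  have h : ∀ d ∈ dirs, ∑ p ∈ bdS S d, a p ≤ ∑ p ∈ S, a p := by
    intro d hd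
    exact Finset.sum_le_sum_of_subset_of_nonneg (Finset.filter_subset _ _) (fun _ _ _ => ha _)
  have := Finset.sum_le_card_nsmul dirs _ _ h
  have hc : dirs.card = 4 := by decide
  rw [hc] at this
  simpa using this

lemma flux_le (S : Finset (ℤ × ℤ)) (V : ℤ × ℤ → ℝ) (d : ℤ × ℤ) :
    ∑ p ∈ S, (V (p + d) - V p) ≤ ∑ p ∈ bdS S d, |V (p + d)| + ∑ p ∈ bdS S (-d), |V p| := by
  rw [Finset.sum_sub_distrib]
  rw [← Finset.sum_filter_add_sum_filter_not S (fun p => p + d ∈ S) (fun p => V (p + d))]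
  rw [← Finset.sum_filter_add_sum_filter_not S (fun p => p + -d ∈ S) (fun p => V p)]
  have e : ∑ p ∈ S with p + d ∈ S, V (p + d) = ∑ p ∈ S with p + -d ∈ S, V p := by
    refine Finset.sum_nbij (· + d) ?_ ?_ ?_ ?_
    · intro p hp
      simp only [Finset.mem_filter] at hp ⊢
      exact ⟨hp.2, by simpa using hp.1⟩
    · intro x _ y _ h
      exact add_right_cancel h
    · intro p hp
      simp only [Finset.coe_filter, mem_ofPred_eq] at hp
      refine ⟨p + -d, ?_, by simp⟩
      simp only [Finset.coe_filter, mem_ofPred_eq]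
      exact ⟨hp.2, by simpa using hp.1⟩
    · intro p _; rfl
  have h1 : ∑ p ∈ S with p + d ∉ S, V (p + d) ≤ ∑ p ∈ bdS S d, |V (p + d)| :=
    Finset.sum_le_sum fun _ _ => le_abs_self _
  have h2 : -∑ p ∈ S with p + -d ∉ S, V p ≤ ∑ p ∈ bdS S (-d), |V p| := by
    rw [← Finset.sum_neg_distrib]
    exact Finset.sum_le_sum fun _ _ => neg_le_abs _
  linarith

lemma exists_unitSquare (x : E2) : ∃ p : ℤ × ℤ, x ∈ unitSquare p :=
  ⟨(⌊x 0⌋, ⌊x 1⌋), Int.floor_le _, (Int.lt_floor_add_one _).le, Int.floor_le _,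
    (Int.lt_floor_add_one _).le⟩

lemma exists_out {S : Finset (ℤ × ℤ)} {x : E2} (hx : x ∈ closure (polymerOf S)ᶜ) :
    ∃ q, q ∉ S ∧ x ∈ unitSquare q := by
  classical
  set T : Finset (ℤ × ℤ) :=
    (Finset.Icc (⌊x 0⌋ - 3) (⌊x 0⌋ + 3) ×ˢ Finset.Icc (⌊x 1⌋ - 3) (⌊x 1⌋ + 3)) \ S with hT
  set O : Set E2 := {y | x 0 - 1 < y 0 ∧ y 0 < x 0 + 1 ∧ x 1 - 1 < y 1 ∧ y 1 < x 1 + 1} with hO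
  have hc : ∀ i : Fin 2, Continuous fun y : E2 => y i := fun i => by fun_prop
  have hOo : IsOpen O :=
    (isOpen_lt continuous_const (hc 0)).inter ((isOpen_lt (hc 0) continuous_const).inter
      ((isOpen_lt continuous_const (hc 1)).inter (isOpen_lt (hc 1) continuous_const)))
  have hxO : x ∈ O := ⟨by linarith, by linarith, by linarith, by linarith⟩
  have h1 : x ∈ closure (O ∩ (polymerOf S)ᶜ) := hOo.inter_closure ⟨hxO, hx⟩
  have h2 : O ∩ (polymerOf S)ᶜ ⊆ polymerOf T := by
    rintro y ⟨⟨a, b, c, d⟩, hy⟩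
    obtain ⟨q, hq⟩ := exists_unitSquare y
    refine mem_polymerOf.2 ⟨q, ?_, hq⟩
    have hqS : q ∉ S := fun h => hy (mem_polymerOf.2 ⟨q, h, hq⟩)
    obtain ⟨a', b', c', d'⟩ := hq
    have f1 := Int.floor_le (x 0)
    have f2 := Int.lt_floor_add_one (x 0)
    have f3 := Int.floor_le (x 1)
    have f4 := Int.lt_floor_add_one (x 1)
    have g1 : (q.1 : ℝ) < ⌊x 0⌋ + 2 := by linarith
    have g2 : (⌊x 0⌋ : ℝ) < q.1 + 2 := by linarith
    have g3 : (q.2 : ℝ) < ⌊x 1⌋ + 2 := by linarith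
    have g4 : (⌊x 1⌋ : ℝ) < q.2 + 2 := by linarith
    norm_cast at g1 g2 g3 g4
    simp only [hT, Finset.mem_sdiff, Finset.mem_product, Finset.mem_Icc]
    exact ⟨⟨⟨by omega, by omega⟩, ⟨by omega, by omega⟩⟩, hqS⟩
  have h3 : x ∈ polymerOf T := (isCompact_polymerOf T).isClosed.closure_subset_iff.2 h2 h1
  obtain ⟨q, hq, hxq⟩ := mem_polymerOf.1 h3
  exact ⟨q, (Finset.mem_sdiff.1 hq).2, hxq⟩

lemma exists_edge {S : Finset (ℤ × ℤ)} {x : E2} (hx : x ∈ frontier (polymerOf S)) :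
    ∃ d ∈ dirs, ∃ p ∈ bdS S d, x ∈ unitSquare p ∩ unitSquare (p + d) := by
  rw [frontier_eq_closure_inter_closure, (isCompact_polymerOf S).isClosed.closure_eq] at hx
  obtain ⟨p, hp, hxp⟩ := mem_polymerOf.1 hx.1
  obtain ⟨q, hq, hxq⟩ := exists_out hx.2
  obtain ⟨a, b, c, d⟩ := hxp
  obtain ⟨a', b', c', d'⟩ := hxq
  have g1 : (q.1 : ℝ) ≤ p.1 + 1 := by linarith
  have g2 : (p.1 : ℝ) ≤ q.1 + 1 := by linarith
  have g3 : (q.2 : ℝ) ≤ p.2 + 1 := by linarith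
  have g4 : (p.2 : ℝ) ≤ q.2 + 1 := by linarith
  norm_cast at g1 g2 g3 g4
  by_cases hr : ((q.1, p.2) : ℤ × ℤ) ∈ S
  · have hne : q.2 ≠ p.2 := fun h => hq (by rw [← h] at hr; exact hr)
    have e : ((q.1, p.2) : ℤ × ℤ) + (0, q.2 - p.2) = q := by ext <;> simp
    refine ⟨(0, q.2 - p.2), ?_, (q.1, p.2), ?_, ⟨a', b', c, d⟩, ?_⟩
    · have : q.2 - p.2 = 1 ∨ q.2 - p.2 = -1 := by omega
      rcases this with h | h <;> rw [h] <;> decide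
    · simp only [bdS, Finset.mem_filter]; rw [e]; exact ⟨hr, hq⟩
    · rw [e]; exact ⟨a', b', c', d'⟩
  · have hne : q.1 ≠ p.1 := fun h => hr (by rw [h]; exact hp)
    have e : p + (q.1 - p.1, 0) = ((q.1, p.2) : ℤ × ℤ) := by ext <;> simp
    refine ⟨(q.1 - p.1, 0), ?_, p, ?_, ⟨a, b, c, d⟩, ?_⟩
    · have : q.1 - p.1 = 1 ∨ q.1 - p.1 = -1 := by omega
      rcases this with h | h <;> rw [h] <;> decide
    · simp only [bdS, Finset.mem_filter]; rw [e]; exact ⟨hp, hr⟩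
    · rw [e]; exact ⟨a', b', c, d⟩

lemma hm_seg0 (c a : ℝ) (A : Set E2) (hA : ∀ x ∈ A, x 0 = c ∧ a ≤ x 1 ∧ x 1 ≤ a + 1) :
    μH[1] A ≤ 1 := by
  have hsub : A ⊆ segment ℝ (mkE (c, a)) (mkE (c, a + 1)) := by
    intro x hx
    obtain ⟨h0, h1, h2⟩ := hA x hx
    rw [segment_eq_image']
    refine ⟨x 1 - a, ⟨by linarith, by linarith⟩, ?_⟩
    ext i
    fin_cases i <;> simp [mkE, h0]
  refine (measure_mono hsub).trans ?_
  rw [hausdorffMeasure_segment, edist_dist, dist_eq_norm]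
  have : mkE (c, a) - mkE (c, a + 1) = - e1 := by
    ext i
    fin_cases i <;> simp [mkE, e1]
  rw [this, norm_neg, norm_e1]; simp

lemma hm_seg1 (c a : ℝ) (A : Set E2) (hA : ∀ x ∈ A, x 1 = c ∧ a ≤ x 0 ∧ x 0 ≤ a + 1) :
    μH[1] A ≤ 1 := by
  have hsub : A ⊆ segment ℝ (mkE (a, c)) (mkE (a + 1, c)) := by
    intro x hx
    obtain ⟨h0, h1, h2⟩ := hA x hx
    rw [segment_eq_image']
    refine ⟨x 0 - a, ⟨by linarith, by linarith⟩, ?_⟩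
    ext i
    fin_cases i <;> simp [mkE, h0]
  refine (measure_mono hsub).trans ?_
  rw [hausdorffMeasure_segment, edist_dist, dist_eq_norm]
  have : mkE (a, c) - mkE (a + 1, c) = - e0 := by
    ext i
    fin_cases i <;> simp [mkE, e0]
  rw [this, norm_neg, norm_e0]; simp

lemma hm_edge {d : ℤ × ℤ} (hd : d ∈ dirs) (p : ℤ × ℤ) :
    μH[1] (unitSquare p ∩ unitSquare (p + d)) ≤ 1 := by
  simp only [dirs, Finset.mem_insert, Finset.mem_singleton] at hd
  rcases hd with rfl | rfl | rfl | rfl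
  · refine hm_seg0 (p.1 + 1) p.2 _ ?_
    rintro x ⟨⟨a, b, c, d⟩, a', b', c', d'⟩
    simp at a' b' c' d'
    exact ⟨by linarith, c, d⟩
  · refine hm_seg0 p.1 p.2 _ ?_
    rintro x ⟨⟨a, b, c, d⟩, a', b', c', d'⟩
    simp at a' b' c' d'
    exact ⟨by linarith, c, d⟩
  · refine hm_seg1 (p.2 + 1) p.1 _ ?_
    rintro x ⟨⟨a, b, c, d⟩, a', b', c', d'⟩
    simp at a' b' c' d'
    exact ⟨by linarith, a, b⟩
  · refine hm_seg1 p.2 p.1 _ ?_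
    rintro x ⟨⟨a, b, c, d⟩, a', b', c', d'⟩
    simp at a' b' c' d'
    exact ⟨by linarith, a, b⟩

lemma integral_frontier_le (S : Finset (ℤ × ℤ)) (g : E2 → ℝ) (hg : ∀ x, 0 ≤ g x)
    (C : ℤ × ℤ → ℤ × ℤ → ℝ) (hC0 : ∀ d p, 0 ≤ C d p)
    (hC : ∀ d ∈ dirs, ∀ p ∈ bdS S d, ∀ x ∈ unitSquare p ∩ unitSquare (p + d), g x ≤ C d p) :
    ∫ x in frontier (polymerOf S), g x ∂(μH[1]) ≤ ∑ d ∈ dirs, ∑ p ∈ bdS S d, C d p := by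
  classical
  set I : Finset ((ℤ × ℤ) × (ℤ × ℤ)) := dirs.sigma (fun d => bdS S d) |>.image
    (fun s => (s.1, s.2)) with hI
  have hmemI : ∀ s, s ∈ I ↔ s.1 ∈ dirs ∧ s.2 ∈ bdS S s.1 := by
    rintro ⟨d, p⟩
    simp [hI]
  set E : I → Set E2 := fun s => unitSquare s.1.2 ∩ unitSquare (s.1.2 + s.1.1) with hE
  have hsub : frontier (polymerOf S) ⊆ ⋃ s : I, E s := by
    intro x hx
    obtain ⟨d, hd, p, hp, hxe⟩ := exists_edge hx
    exact mem_iUnion.2 ⟨⟨(d, p), (hmemI _).2 ⟨hd, hp⟩⟩, hxe⟩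
  have hsum0 : 0 ≤ ∑ d ∈ dirs, ∑ p ∈ bdS S d, C d p :=
    Finset.sum_nonneg fun _ _ => Finset.sum_nonneg fun _ _ => hC0 _ _
  have hsumE : ∑ d ∈ dirs, ∑ p ∈ bdS S d, C d p = ∑ s : I, C s.1.1 s.1.2 := by
    rw [Finset.sum_coe_sort I (fun s => C s.1 s.2)]
    rw [hI, Finset.sum_image, Finset.sum_sigma]
    rintro ⟨a, b⟩ _ ⟨c, d⟩ _ h
    simpa using h
  have hl : ∫⁻ x in frontier (polymerOf S), ENNReal.ofReal ‖g x‖ ∂(μH[1]) ≤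
      ENNReal.ofReal (∑ d ∈ dirs, ∑ p ∈ bdS S d, C d p) := by
    calc _ ≤ ∫⁻ x in ⋃ s : I, E s, ENNReal.ofReal ‖g x‖ ∂(μH[1]) := lintegral_mono_set hsub
      _ ≤ ∑' s : I, ∫⁻ x in E s, ENNReal.ofReal ‖g x‖ ∂(μH[1]) := lintegral_iUnion_le _ _
      _ = ∑ s : I, ∫⁻ x in E s, ENNReal.ofReal ‖g x‖ ∂(μH[1]) := tsum_fintype _
      _ ≤ ∑ s : I, ENNReal.ofReal (C s.1.1 s.1.2) := by
          refine Finset.sum_le_sum fun s _ => ?_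
          obtain ⟨hd, hp⟩ := (hmemI _).1 s.2
          calc _ ≤ ∫⁻ x in E s, ENNReal.ofReal (C s.1.1 s.1.2) ∂(μH[1]) := by
                refine setLIntegral_mono' ((measurableSet_unitSquare _).inter
                  (measurableSet_unitSquare _)) ?_
                intro x hx
                rw [Real.norm_of_nonneg (hg x)]
                exact ENNReal.ofReal_le_ofReal (hC _ hd _ hp x hx)
            _ = ENNReal.ofReal (C s.1.1 s.1.2) * μH[1] (E s) := setLIntegral_const _ _
            _ ≤ ENNReal.ofReal (C s.1.1 s.1.2) * 1 := by
                gcongr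
                exact hm_edge hd _
            _ = _ := mul_one _
      _ = _ := by
          rw [hsumE, ENNReal.ofReal_sum_of_nonneg]
          intro _ _; exact hC0 _ _
  have h1 := norm_integral_le_lintegral_norm (μ := (μH[1]).restrict (frontier (polymerOf S))) g
  exact (le_abs_self _).trans (h1.trans (ENNReal.toReal_le_of_le_ofReal hsum0 hl))

/-! ### The core inequality -/

lemma bdS_sub {S : Finset (ℤ × ℤ)} {d p : ℤ × ℤ} (h : p ∈ bdS S d) : p ∈ S :=
  (Finset.mem_filter.1 h).1

lemma disjoint_nbS (S : Finset (ℤ × ℤ)) : Disjoint S (nbS S) := by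
  rw [Finset.disjoint_left]
  intro q hq hn
  simp only [nbS, Finset.mem_biUnion, Finset.mem_image] at hn
  obtain ⟨d, _, p, hp, rfl⟩ := hn
  exact (Finset.mem_filter.1 hp).2 hq

lemma total_flux_le {F ψ : E2 → ℝ} {W V : Set E2} {S : Finset (ℤ × ℤ)} (hW : IsOpen W)
    (hV : IsOpen V) (hF : ContDiffOn ℝ 2 F W) (hψ : ContDiffOn ℝ 2 ψ V)
    (hSW : polymerOf (S ∪ nbS S) ⊆ W) (hSV : polymerOf S ⊆ V) :
    ∑ p ∈ S, (Vf F ψ (p + (1, 0)) - Vf F ψ p + (Hf F ψ (p + (0, 1)) - Hf F ψ p)) ≤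
      1 / 8 * ∑ p ∈ nbS S, bs 1 F p + 32 * ∑ p ∈ S, bs 0 ψ p := by
  have hFb : ∀ d ∈ dirs, ∀ p ∈ bdS S d, ∀ x ∈ unitSquare (p + d),
      dNorm 1 F x ^ 2 ≤ bs 1 F (p + d) := by
    intro d hd p hp x hx
    have hsub : unitSquare (p + d) ⊆ W :=
      (unitSquare_subset_polymerOf (Finset.mem_union_right _ (mem_nbS hd hp))).trans hSW
    exact le_bs ((cont_dNorm hW hF (by norm_num)).mono hsub) hx
  have hψb : ∀ p ∈ S, ∀ x ∈ unitSquare p, dNorm 0 ψ x ^ 2 ≤ bs 0 ψ p := by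
    intro p hp x hx
    exact le_bs ((cont_dNorm hV hψ (by norm_num)).mono
      ((unitSquare_subset_polymerOf hp).trans hSV)) hx
  have d1 : ((1, 0) : ℤ × ℤ) ∈ dirs := by decide
  have d2 : (-(1, 0) : ℤ × ℤ) ∈ dirs := by decide
  have d3 : ((0, 1) : ℤ × ℤ) ∈ dirs := by decide
  have d4 : (-(0, 1) : ℤ × ℤ) ∈ dirs := by decide
  set R : ℤ × ℤ → ℤ × ℤ → ℝ := fun d p => bs 1 F (p + d) / 32 + 8 * bs 0 ψ p with hR
  have h1 : ∑ p ∈ bdS S (1, 0), |Vf F ψ (p + (1, 0))| ≤ ∑ p ∈ bdS S (1, 0), R (1, 0) p := by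
    refine Finset.sum_le_sum fun p hp => Vf_le rfl (fun x hx _ => hFb _ d1 p hp x hx) ?_
    intro x hx h0
    refine hψb p (bdS_sub hp) x ?_
    obtain ⟨a, b, c, d⟩ := hx
    simp at a b c d h0
    exact ⟨by linarith, by linarith, c, d⟩
  have h2 : ∑ p ∈ bdS S (-(1, 0)), |Vf F ψ p| ≤ ∑ p ∈ bdS S (-(1, 0)), R (-(1, 0)) p := by
    refine Finset.sum_le_sum fun p hp => Vf_le rfl ?_ (fun x hx _ => hψb p (bdS_sub hp) x hx)
    intro x hx h0
    refine hFb _ d2 p hp x ?_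
    obtain ⟨a, b, c, d⟩ := hx
    refine ⟨?_, ?_, ?_, ?_⟩ <;> simp <;> linarith
  have h3 : ∑ p ∈ bdS S (0, 1), |Hf F ψ (p + (0, 1))| ≤ ∑ p ∈ bdS S (0, 1), R (0, 1) p := by
    refine Finset.sum_le_sum fun p hp => Hf_le rfl (fun x hx _ => hFb _ d3 p hp x hx) ?_
    intro x hx h0
    refine hψb p (bdS_sub hp) x ?_
    obtain ⟨a, b, c, d⟩ := hx
    simp at a b c d h0
    exact ⟨a, b, by linarith, by linarith⟩
  have h4 : ∑ p ∈ bdS S (-(0, 1)), |Hf F ψ p| ≤ ∑ p ∈ bdS S (-(0, 1)), R (-(0, 1)) p := by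
    refine Finset.sum_le_sum fun p hp => Hf_le rfl ?_ (fun x hx _ => hψb p (bdS_sub hp) x hx)
    intro x hx h0
    refine hFb _ d4 p hp x ?_
    obtain ⟨a, b, c, d⟩ := hx
    refine ⟨?_, ?_, ?_, ?_⟩ <;> simp <;> linarith
  have f1 := flux_le S (Vf F ψ) (1, 0)
  have f2 := flux_le S (Hf F ψ) (0, 1)
  have hdirs : ∑ d ∈ dirs, ∑ p ∈ bdS S d, R d p =
      ∑ p ∈ bdS S (1, 0), R (1, 0) p + (∑ p ∈ bdS S (-(1, 0)), R (-(1, 0)) p +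
      (∑ p ∈ bdS S (0, 1), R (0, 1) p + ∑ p ∈ bdS S (-(0, 1)), R (-(0, 1)) p)) := by
    rw [dirs, Finset.sum_insert (by decide), Finset.sum_insert (by decide),
      Finset.sum_insert (by decide), Finset.sum_singleton]
    rfl
  have hR2 : ∑ d ∈ dirs, ∑ p ∈ bdS S d, R d p =
      1 / 32 * ∑ d ∈ dirs, ∑ p ∈ bdS S d, bs 1 F (p + d) +
      8 * ∑ d ∈ dirs, ∑ p ∈ bdS S d, bs 0 ψ p := by
    simp only [hR, Finset.mul_sum, ← Finset.sum_add_distrib]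
    refine Finset.sum_congr rfl fun d _ => Finset.sum_congr rfl fun p _ => ?_
    ring
  have g1 := sum_nbS_le S (bs 1 F) (bs_nonneg 1 F)
  have g2 := sum_bdS_le S (bs 0 ψ) (bs_nonneg 0 ψ)
  rw [Finset.sum_add_distrib]
  linarith

lemma core {F ψ : E2 → ℝ} {W V : Set E2} {S : Finset (ℤ × ℤ)} (hW : IsOpen W)
    (hV : IsOpen V) (hF : ContDiffOn ℝ 2 F W) (hψ : ContDiffOn ℝ 2 ψ V)
    (hSW : polymerOf (S ∪ nbS S) ⊆ W) (hSV : polymerOf S ⊆ V) :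
    1 * ((∫ x in polymerOf S, dNorm 1 (fun x => F x + ψ x) x ^ 2) +
        blockSumSup 2 (fun x => F x + ψ x) (polymerOf S)) +
      1 / 32 * (∫ x in frontier (polymerOf S), dNorm 1 (fun x => F x + ψ x) x ^ 2 ∂(μH[1])) ≤
    (∫ x in polymerOf (S ∪ nbS S), dNorm 1 F x ^ 2) + 4 * ∑ p ∈ S ∪ nbS S, bs 2 F p +
      66 * (blockSumSup 0 ψ (polymerOf S) + blockSumSup 1 ψ (polymerOf S) +
        blockSumSup 2 ψ (polymerOf S)) := by
  have hSW' : polymerOf S ⊆ W := by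
    refine Subset.trans ?_ hSW
    intro x hx
    obtain ⟨p, hp, h⟩ := mem_polymerOf.1 hx
    exact mem_polymerOf.2 ⟨p, Finset.mem_union_left _ hp, h⟩
  have hU : IsOpen (W ∩ V) := hW.inter hV
  have hFU := hF.mono (inter_subset_left : W ∩ V ⊆ W)
  have hψU := hψ.mono (inter_subset_right : W ∩ V ⊆ V)
  have hSU : polymerOf S ⊆ W ∩ V := subset_inter hSW' hSV
  have hpU : ∀ p ∈ S, unitSquare p ⊆ W ∩ V := fun p hp =>
    (unitSquare_subset_polymerOf hp).trans hSU
  have hsum : ContDiffOn ℝ 2 (fun x => F x + ψ x) (W ∩ V) := hFU.add hψU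
  have i1 : IntegrableOn (fun x => dNorm 1 (fun x => F x + ψ x) x ^ 2) (polymerOf S) :=
    (((cont_dNorm hU hsum (n := 1) (by norm_num)).mono hSU).pow 2).integrableOn_compact
      (isCompact_polymerOf S)
  have i2 : IntegrableOn (fun x => dNorm 1 F x ^ 2) (polymerOf (S ∪ nbS S)) :=
    (((cont_dNorm hW hF (n := 1) (by norm_num)).mono hSW).pow 2).integrableOn_compact
      (isCompact_polymerOf _)
  rw [setIntegral_polymerOf S _ i1, setIntegral_polymerOf (S ∪ nbS S) _ i2,
    blockSumSup_polymerOf, blockSumSup_polymerOf, blockSumSup_polymerOf, blockSumSup_polymerOf]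
  change 1 * (_ + ∑ p ∈ S, bs 2 (fun x => F x + ψ x) p) + _ ≤
    _ + _ + 66 * (∑ p ∈ S, bs 0 ψ p + ∑ p ∈ S, bs 1 ψ p + ∑ p ∈ S, bs 2 ψ p)
  rw [Finset.sum_union (disjoint_nbS S), Finset.sum_union (disjoint_nbS S)]
  have t1 := Finset.sum_le_sum fun p hp => block_main hU hFU hψU (hpU p hp)
  simp only [Finset.sum_add_distrib, ← Finset.mul_sum] at t1
  have t2 := Finset.sum_le_sum fun p hp => bs2_add_le hU hFU hψU (hpU p hp)
  simp only [Finset.sum_add_distrib, ← Finset.mul_sum] at t2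
  have t3 := total_flux_le hW hV hF hψ hSW hSV
  simp only [Finset.sum_add_distrib] at t3
  have t4 := integral_frontier_le S (fun x => dNorm 1 (fun x => F x + ψ x) x ^ 2)
    (fun _ => sq_nonneg _) (fun d p => 2 * bs 1 F (p + d) + 2 * bs 1 ψ p)
    (fun d p => by
      have h1 : 0 ≤ bs 1 F (p + d) := bs_nonneg _ _ _
      have h2 : 0 ≤ bs 1 ψ p := bs_nonneg _ _ _
      positivity)
    (by
      rintro d hd p hp x ⟨hx, hx'⟩
      refine (grad_add_sq_le hU hFU hψU (hpU p (bdS_sub hp) hx)).trans ?_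
      have hsub : unitSquare (p + d) ⊆ W :=
        (unitSquare_subset_polymerOf (Finset.mem_union_right _ (mem_nbS hd hp))).trans hSW
      have h1 : dNorm 1 F x ^ 2 ≤ bs 1 F (p + d) :=
        le_bs ((cont_dNorm hW hF (by norm_num)).mono hsub) hx'
      have h2 : dNorm 1 ψ x ^ 2 ≤ bs 1 ψ p :=
        le_bs ((cont_dNorm hU hψU (by norm_num)).mono (hpU p (bdS_sub hp))) hx
      linarith)
  simp only [Finset.sum_add_distrib, ← Finset.mul_sum] at t4
  have g1 := sum_nbS_le S (bs 1 F) (bs_nonneg 1 F)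
  have g2 := sum_bdS_le S (bs 1 ψ) (bs_nonneg 1 ψ)
  have t5 : ∑ p ∈ nbS S, bs 1 F p ≤ ∑ p ∈ nbS S,
      (2 * (∫ y in unitSquare p, dNorm 1 F y ^ 2) + 4 * bs 2 F p) := by
    refine Finset.sum_le_sum fun p hp => sup_grad_le hW hF ?_
    exact (unitSquare_subset_polymerOf (Finset.mem_union_right _ hp)).trans hSW
  simp only [Finset.sum_add_distrib, ← Finset.mul_sum] at t5
  have n0 : 0 ≤ ∑ p ∈ S, bs 0 ψ p := Finset.sum_nonneg fun p _ => bs_nonneg _ _ _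
  have n1 : 0 ≤ ∑ p ∈ S, bs 1 ψ p := Finset.sum_nonneg fun p _ => bs_nonneg _ _ _
  have n2 : 0 ≤ ∑ p ∈ S, bs 2 ψ p := Finset.sum_nonneg fun p _ => bs_nonneg _ _ _
  have n3 : 0 ≤ ∑ p ∈ nbS S, bs 2 F p := Finset.sum_nonneg fun p _ => bs_nonneg _ _ _
  have n4 : 0 ≤ ∑ p ∈ S, bs 2 F p := Finset.sum_nonneg fun p _ => bs_nonneg _ _ _
  linarith

/-! ### Rescaling -/

lemma dNorm_one_scale (φ : E2 → ℝ) {c : ℝ} (hc : 0 < c) (x : E2) :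
    dNorm 1 (fun x => φ (c • x)) x = c * dNorm 1 φ (c • x) := by
  rw [dNorm_one, dNorm_one, fderiv_comp_smul, norm_smul, Real.norm_of_nonneg hc.le]

set_option maxSynthPendingDepth 3 in
lemma dNorm_two_scale (φ : E2 → ℝ) {c : ℝ} (hc : 0 < c) (x : E2) :
    dNorm 2 (fun x => φ (c • x)) x = c ^ 2 * dNorm 2 φ (c • x) := by
  have h : fderiv ℝ (fun x => φ (c • x)) = fun x => c • fderiv ℝ φ (c • x) := by
    funext y
    exact fderiv_comp_smul (f := φ) (x := y) c
  have h2 : fderiv ℝ (fun x => c • fderiv ℝ φ (c • x)) x =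
      c • c • fderiv ℝ (fderiv ℝ φ) (c • x) := by
    have := fderiv_comp_smul (f := c • fderiv ℝ φ) (x := x) c
    have e : fderiv ℝ (c • fderiv ℝ φ) (c • x) = c • fderiv ℝ (fderiv ℝ φ) (c • x) := by
      exact congrFun (fderiv_const_smul_field (𝕜 := ℝ) (f := fderiv ℝ φ) c) (c • x)
    rw [e] at this
    exact this
  rw [dNorm_two, dNorm_two, h, h2, norm_smul, norm_smul, Real.norm_of_nonneg hc.le]
  ring

lemma mem_unitSquare_scale {ℓ : ℤ} (hℓ : 0 < ℓ) (q : ℤ × ℤ) (x : E2) :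
    (ℓ : ℝ)⁻¹ • x ∈ unitSquare q ↔ x ∈ bigSquare ℓ q := by
  have h : (0 : ℝ) < ℓ := by exact_mod_cast hℓ
  simp only [unitSquare, bigSquare, mem_ofPred_eq, PiLp.smul_apply, smul_eq_mul]
  push_cast
  rw [le_inv_mul_iff₀ h, inv_mul_le_iff₀ h, le_inv_mul_iff₀ h, inv_mul_le_iff₀ h]

/-- The coarse block containing a given fine block. -/
def cs (ℓ : ℤ) (p : ℤ × ℤ) : ℤ × ℤ := (p.1 / ℓ, p.2 / ℓ)

lemma unitSquare_subset_big {ℓ : ℤ} (hℓ : 0 < ℓ) (p : ℤ × ℤ) :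
    unitSquare p ⊆ bigSquare ℓ (cs ℓ p) := by
  rintro x ⟨h1, h2, h3, h4⟩
  have a1 : ℓ * (p.1 / ℓ) ≤ p.1 := Int.mul_ediv_self_le hℓ.ne'
  have a2 : p.1 + 1 ≤ ℓ * (p.1 / ℓ + 1) := by
    have := Int.lt_mul_ediv_self_add (x := p.1) hℓ
    linarith [mul_add ℓ (p.1 / ℓ) 1]
  have b1 : ℓ * (p.2 / ℓ) ≤ p.2 := Int.mul_ediv_self_le hℓ.ne'
  have b2 : p.2 + 1 ≤ ℓ * (p.2 / ℓ + 1) := by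
    have := Int.lt_mul_ediv_self_add (x := p.2) hℓ
    linarith [mul_add ℓ (p.2 / ℓ) 1]
  have a1' : ((ℓ * (p.1 / ℓ) : ℤ) : ℝ) ≤ p.1 := by exact_mod_cast a1
  have a2' : (p.1 : ℝ) + 1 ≤ ((ℓ * (p.1 / ℓ + 1) : ℤ) : ℝ) := by exact_mod_cast a2
  have b1' : ((ℓ * (p.2 / ℓ) : ℤ) : ℝ) ≤ p.2 := by exact_mod_cast b1
  have b2' : (p.2 : ℝ) + 1 ≤ ((ℓ * (p.2 / ℓ + 1) : ℤ) : ℝ) := by exact_mod_cast b2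
  exact ⟨a1'.trans h1, h2.trans a2', b1'.trans h3, h4.trans b2'⟩

lemma coarse_bound {ℓ a b : ℤ} (hℓ : 2 ≤ ℓ) (h1 : ℓ * b ≤ a + 1) (h2 : a ≤ ℓ * (b + 1)) :
    b ∈ Icc (-|a| - 2) (|a| + 2) := by
  have ha := neg_abs_le a
  have ha' := le_abs_self a
  have ha0 := abs_nonneg a
  constructor
  · by_contra hb
    push Not at hb
    nlinarith
  · by_contra hb
    push Not at hb
    nlinarith

lemma finite_coarse {ℓ : ℤ} (hℓ : 2 ≤ ℓ) (S : Finset (ℤ × ℤ)) :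
    {q : ℤ × ℤ | (bigSquare ℓ q ∩ polymerOf S).Nonempty}.Finite := by
  refine (S.finite_toSet.biUnion (t := fun p => (Icc (-|p.1| - 2) (|p.1| + 2)) ×ˢ
    (Icc (-|p.2| - 2) (|p.2| + 2))) fun p _ =>
      (finite_Icc _ _).prod (finite_Icc _ _)).subset ?_
  rintro q ⟨x, ⟨h1, h2, h3, h4⟩, hx⟩
  obtain ⟨p, hp, g1, g2, g3, g4⟩ := mem_polymerOf.1 hx
  refine mem_biUnion hp ⟨coarse_bound hℓ ?_ ?_, coarse_bound hℓ ?_ ?_⟩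
  · exact_mod_cast h1.trans g2
  · exact_mod_cast g1.trans h2
  · exact_mod_cast h3.trans g4
  · exact_mod_cast g3.trans h4

lemma exists_coarse {ℓ : ℤ} (hℓ : 2 ≤ ℓ) (S : Finset (ℤ × ℤ)) :
    ∃ T : Finset (ℤ × ℤ), closureBlock ℓ (polymerOf S) = polymerOf T ∧
      ∀ q, q ∈ T ↔ (bigSquare ℓ q ∩ polymerOf S).Nonempty := by
  refine ⟨(finite_coarse hℓ S).toFinset, ?_, fun q => by simp⟩
  have hℓ0 : 0 < ℓ := by linarith
  have h : (ℓ : ℝ) ≠ 0 := by exact_mod_cast hℓ0.ne'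
  ext x
  rw [mem_polymerOf]
  simp only [closureBlock, Qset, mem_image, mem_iUnion, exists_prop, mem_ofPred_eq,
    Finite.mem_toFinset]
  constructor
  · rintro ⟨y, ⟨q, hq, hy⟩, rfl⟩
    exact ⟨q, hq, (mem_unitSquare_scale hℓ0 q y).2 hy⟩
  · rintro ⟨q, hq, hx⟩
    refine ⟨(ℓ : ℝ) • x, ⟨q, hq, (mem_unitSquare_scale hℓ0 q _).1 ?_⟩, ?_⟩
    · rwa [inv_smul_smul₀ h]
    · rw [inv_smul_smul₀ h]

lemma unitSquare_meets {S : Finset (ℤ × ℤ)} {p : ℤ × ℤ} (hp : p ∈ S ∪ nbS S) :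
    (unitSquare p ∩ polymerOf S).Nonempty := by
  rcases Finset.mem_union.1 hp with hp | hp
  · refine ⟨mkE (p.1, p.2), ?_, mem_polymerOf.2 ⟨p, hp, ?_⟩⟩ <;>
      simp [unitSquare, mkE_zero, mkE_one]
  · simp only [nbS, Finset.mem_biUnion, Finset.mem_image] at hp
    obtain ⟨d, hd, r, hr, rfl⟩ := hp
    have hrS := bdS_sub hr
    simp only [dirs, Finset.mem_insert, Finset.mem_singleton] at hd
    rcases hd with rfl | rfl | rfl | rfl
    · refine ⟨mkE (r.1 + 1, r.2), ?_, mem_polymerOf.2 ⟨r, hrS, ?_⟩⟩ <;>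
        simp [unitSquare, mkE_zero, mkE_one]
    · refine ⟨mkE (r.1, r.2), ?_, mem_polymerOf.2 ⟨r, hrS, ?_⟩⟩ <;>
        simp [unitSquare, mkE_zero, mkE_one]
    · refine ⟨mkE (r.1, r.2 + 1), ?_, mem_polymerOf.2 ⟨r, hrS, ?_⟩⟩ <;>
        simp [unitSquare, mkE_zero, mkE_one]
    · refine ⟨mkE (r.1, r.2), ?_, mem_polymerOf.2 ⟨r, hrS, ?_⟩⟩ <;>
        simp [unitSquare, mkE_zero, mkE_one]

lemma card_fiber_le {ℓ : ℤ} (hℓ : 2 ≤ ℓ) (A : Finset (ℤ × ℤ)) (q : ℤ × ℤ) :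
    ((A.filter fun p => cs ℓ p = q).card : ℝ) ≤ (ℓ : ℝ) ^ 2 := by
  have hℓ0 : 0 < ℓ := by linarith
  have hsub : (A.filter fun p => cs ℓ p = q) ⊆
      (Finset.Ico (ℓ * q.1) (ℓ * q.1 + ℓ)) ×ˢ (Finset.Ico (ℓ * q.2) (ℓ * q.2 + ℓ)) := by
    intro p hp
    obtain ⟨_, rfl⟩ := Finset.mem_filter.1 hp
    simp only [cs, Finset.mem_product, Finset.mem_Ico]
    exact ⟨⟨Int.mul_ediv_self_le hℓ0.ne', Int.lt_mul_ediv_self_add hℓ0⟩,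
      ⟨Int.mul_ediv_self_le hℓ0.ne', Int.lt_mul_ediv_self_add hℓ0⟩⟩
  have h := Finset.card_le_card hsub
  rw [Finset.card_product, Int.card_Ico, Int.card_Ico, add_sub_cancel_left,
    add_sub_cancel_left] at h
  have h2 : ((A.filter fun p => cs ℓ p = q).card : ℝ) ≤ (ℓ.toNat : ℝ) * (ℓ.toNat : ℝ) := by
    exact_mod_cast h
  have h3 : ((ℓ.toNat : ℕ) : ℝ) = (ℓ : ℝ) := by
    have := Int.toNat_of_nonneg hℓ0.le
    exact_mod_cast congrArg (Int.cast : ℤ → ℝ) this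
  rw [h3] at h2
  linarith [sq (ℓ : ℝ)]

lemma scale_all {φ : E2 → ℝ} {U : Set E2} {S T : Finset (ℤ × ℤ)} {ℓ : ℤ} (hℓ : 2 ≤ ℓ)
    (hU : IsOpen U) (hφ : ContDiffOn ℝ 2 φ U)
    (hT : ∀ q, q ∈ T ↔ (bigSquare ℓ q ∩ polymerOf S).Nonempty) (hTU : polymerOf T ⊆ U) :
    polymerOf (S ∪ nbS S) ⊆ (fun x : E2 => (ℓ : ℝ)⁻¹ • x) ⁻¹' U ∧
    (∫ x in polymerOf (S ∪ nbS S), dNorm 1 (fun x => φ ((ℓ : ℝ)⁻¹ • x)) x ^ 2) ≤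
      (∫ x in polymerOf T, dNorm 1 φ x ^ 2) ∧
    4 * ∑ p ∈ S ∪ nbS S, bs 2 (fun x => φ ((ℓ : ℝ)⁻¹ • x)) p ≤ ∑ q ∈ T, bs 2 φ q := by
  have hℓ0 : 0 < ℓ := by linarith
  have hl : (0 : ℝ) < ℓ := by exact_mod_cast hℓ0
  have hl2 : (2 : ℝ) ≤ ℓ := by exact_mod_cast hℓ
  have hc : (0 : ℝ) < (ℓ : ℝ)⁻¹ := inv_pos.2 hl
  have hcs : ∀ p ∈ S ∪ nbS S, cs ℓ p ∈ T := by
    intro p hp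
    obtain ⟨x, hx, hx'⟩ := unitSquare_meets hp
    exact (hT _).2 ⟨x, unitSquare_subset_big hℓ0 p hx, hx'⟩
  have hmap : ∀ p, ∀ x ∈ unitSquare p, (ℓ : ℝ)⁻¹ • x ∈ unitSquare (cs ℓ p) := fun p x hx =>
    (mem_unitSquare_scale hℓ0 _ x).2 (unitSquare_subset_big hℓ0 p hx)
  have hmapT : ∀ x ∈ polymerOf (S ∪ nbS S), (ℓ : ℝ)⁻¹ • x ∈ polymerOf T := by
    intro x hx
    obtain ⟨p, hp, hxp⟩ := mem_polymerOf.1 hx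
    exact mem_polymerOf.2 ⟨_, hcs p hp, hmap p x hxp⟩
  refine ⟨fun x hx => hTU (hmapT x hx), ?_, ?_⟩
  · simp only [dNorm_one_scale φ hc, mul_pow]
    rw [integral_const_mul, Measure.setIntegral_comp_smul_of_pos volume
      (fun x => dNorm 1 φ x ^ 2) _ hc, finrank_euclideanSpace, Fintype.card_fin, smul_eq_mul,
      mul_inv_cancel_left₀ (by positivity)]
    refine setIntegral_mono_set ?_ ?_ ?_
    · exact (((cont_dNorm hU hφ (n := 1) (by norm_num)).mono hTU).pow 2).integrableOn_compact
        (isCompact_polymerOf _)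
    · exact Eventually.of_forall fun x => sq_nonneg _
    · refine Eventually.of_forall ?_
      rintro _ ⟨x, hx, rfl⟩
      exact hmapT x hx
  · have h1 : ∀ p ∈ S ∪ nbS S, bs 2 (fun x => φ ((ℓ : ℝ)⁻¹ • x)) p ≤
        ((ℓ : ℝ)⁻¹ ^ 2) ^ 2 * bs 2 φ (cs ℓ p) := by
      intro p hp
      have h0 : 0 ≤ bs 2 φ (cs ℓ p) := bs_nonneg _ _ _
      refine bs_le (by positivity) fun x hx => ?_
      rw [dNorm_two_scale φ hc, mul_pow]
      refine mul_le_mul_of_nonneg_left ?_ (by positivity)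
      exact le_bs ((cont_dNorm hU hφ (by norm_num)).mono
        ((unitSquare_subset_polymerOf (hcs p hp)).trans hTU)) (hmap p x hx)
    have h2 : ∑ p ∈ S ∪ nbS S, bs 2 φ (cs ℓ p) ≤ (ℓ : ℝ) ^ 2 * ∑ q ∈ T, bs 2 φ q := by
      rw [← Finset.sum_fiberwise_of_maps_to hcs, Finset.mul_sum]
      refine Finset.sum_le_sum fun q _ => ?_
      rw [Finset.sum_congr rfl (g := fun _ => bs 2 φ q)
        (fun p hp => by rw [(Finset.mem_filter.1 hp).2]), Finset.sum_const, nsmul_eq_mul]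
      exact mul_le_mul_of_nonneg_right (card_fiber_le hℓ _ q) (bs_nonneg _ _ _)
    have h0 : 0 ≤ ∑ q ∈ T, bs 2 φ q := Finset.sum_nonneg fun _ _ => bs_nonneg _ _ _
    have h3 : 4 * ((ℓ : ℝ)⁻¹ ^ 2) ≤ 1 := by
      rw [inv_pow, ← div_eq_mul_inv, div_le_one (by positivity)]
      nlinarith
    calc 4 * ∑ p ∈ S ∪ nbS S, bs 2 (fun x => φ ((ℓ : ℝ)⁻¹ • x)) p
        ≤ 4 * ∑ p ∈ S ∪ nbS S, ((ℓ : ℝ)⁻¹ ^ 2) ^ 2 * bs 2 φ (cs ℓ p) := by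
          gcongr with p hp
          exact h1 p hp
      _ = 4 * (((ℓ : ℝ)⁻¹ ^ 2) ^ 2 * ∑ p ∈ S ∪ nbS S, bs 2 φ (cs ℓ p)) := by
          rw [← Finset.mul_sum]
      _ ≤ 4 * (((ℓ : ℝ)⁻¹ ^ 2) ^ 2 * ((ℓ : ℝ) ^ 2 * ∑ q ∈ T, bs 2 φ q)) := by gcongr
      _ = 4 * ((ℓ : ℝ)⁻¹ ^ 2) * ∑ q ∈ T, bs 2 φ q := by
          field_simp
      _ ≤ 1 * ∑ q ∈ T, bs 2 φ q := mul_le_mul_of_nonneg_right h3 h0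
      _ = _ := one_mul _

lemma final_bound {φ ψ : E2 → ℝ} {U V : Set E2} {S : Finset (ℤ × ℤ)} {ℓ : ℤ} {κ : ℝ}
    (hℓ : 2 ≤ ℓ) (hκ : 0 < κ) (hU : IsOpen U) (hV : IsOpen V)
    (hSU : closureBlock ℓ (polymerOf S) ⊆ U) (hSV : polymerOf S ⊆ V)
    (hφ : ContDiffOn ℝ 2 φ U) (hψ : ContDiffOn ℝ 2 ψ V) :
    Greg 1 (1 / 32) κ (polymerOf S) (fun x => φ ((ℓ : ℝ)⁻¹ • x) + ψ x) ≤
      Greg 1 (1 / 32) κ (closureBlock ℓ (polymerOf S)) φ * greg 66 κ (polymerOf S) ψ := by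
  obtain ⟨T, hT, hT'⟩ := exists_coarse hℓ S
  rw [hT] at hSU ⊢
  obtain ⟨h1, h2, h3⟩ := scale_all hℓ hU hφ hT' hSU
  have hcont : Continuous (fun x : E2 => (ℓ : ℝ)⁻¹ • x) := continuous_const_smul _
  have hF : ContDiffOn ℝ 2 (fun x : E2 => φ ((ℓ : ℝ)⁻¹ • x))
      ((fun x : E2 => (ℓ : ℝ)⁻¹ • x) ⁻¹' U) :=
    hφ.comp (contDiff_const_smul _).contDiffOn (fun x hx => hx)
  have hcore := core (hU.preimage hcont) hV hF hψ h1 hSV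
  have hfr : 0 ≤ ∫ x in frontier (polymerOf T), dNorm 1 φ x ^ 2 ∂(μH[1]) :=
    integral_nonneg fun _ => sq_nonneg _
  have hb : blockSumSup 2 φ (polymerOf T) = ∑ q ∈ T, bs 2 φ q := blockSumSup_polymerOf 2 φ T
  unfold Greg greg
  rw [← Real.exp_add, Real.exp_le_exp, mul_assoc, ← mul_add]
  refine mul_le_mul_of_nonneg_left ?_ (inv_pos.2 hκ).le
  rw [hb]
  linarith

end

/-- There are constants `c₁, c₂, c₃ > 0` and an integer `ℓ₀ ≥ 2` such that for all
`ℓ ≥ ℓ₀`, `κ > 0`, every connected polymer `X`, every `φ` of class `C²` on a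
neighborhood of `X̄⁽¹⁾` and every `ψ` of class `C²` on a neighborhood of `X`:
`G_κ(X, S_ℓ φ + ψ) ≤ G_κ(X̄⁽¹⁾, φ) · g_κ(X, ψ)`, where `(S_ℓ φ)(x) = φ(x/ℓ)`. -/
theorem stmt10 :
    ∃ c₁ c₂ c₃ : ℝ, 0 < c₁ ∧ 0 < c₂ ∧ 0 < c₃ ∧
      ∃ ℓ₀ : ℤ, 2 ≤ ℓ₀ ∧
        ∀ ℓ : ℤ, ℓ₀ ≤ ℓ →
          ∀ κ : ℝ, 0 < κ →
            ∀ S : Finset (ℤ × ℤ), S.Nonempty → IsConnected (polymerOf S) →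
              ∀ (φ ψ : E2 → ℝ) (U V : Set E2), IsOpen U → IsOpen V →
                closureBlock ℓ (polymerOf S) ⊆ U → polymerOf S ⊆ V →
                ContDiffOn ℝ 2 φ U → ContDiffOn ℝ 2 ψ V →
                Greg c₁ c₂ κ (polymerOf S) (fun x => φ ((ℓ : ℝ)⁻¹ • x) + ψ x) ≤
                  Greg c₁ c₂ κ (closureBlock ℓ (polymerOf S)) φ *
                    greg c₃ κ (polymerOf S) ψ := by
  refine ⟨1, 1 / 32, 66, by norm_num, by norm_num, by norm_num, 2, le_rfl, ?_⟩
  intro ℓ hℓ κ hκ S _ _ φ ψ U V hU hV hSU hSV hφ hψ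
  exact final_bound hℓ hκ hU hV hSU hSV hφ hψ

end
end

section
/- Let E be a real Banach space, F : E → ℝ infinitely Fréchet differentiable, m ∈ ℕ, h > 0, and φ ∈ E. Define the m-th Taylor remainder Rem_m F(ψ) = F(ψ) − Σ_{k=0}^{m} (1/k!)·DᵏF(0)[ψ,…,ψ]. Then, as an inequality in [0,∞]: ‖Rem_m F‖_{h;φ} ≤ (1 + ‖φ‖/h)^{m+1} · sup_{t∈[0,1]} Σ_{n=m+1}^{∞} (hⁿ/n!)·‖DⁿF(tφ)‖. -/
open scoped ENNReal

/-- The formal series norm `‖F‖_{h;x} = Σ_{n=0}^∞ (hⁿ/n!) ‖DⁿF(x)‖ ∈ [0,∞]`. -/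
noncomputable def seriesNorm {E : Type*} [NormedAddCommGroup E] [NormedSpace ℝ E]
    (h : ℝ) (F : E → ℝ) (x : E) : ℝ≥0∞ :=
  ∑' n : ℕ, ENNReal.ofReal (h ^ n / n.factorial * ‖iteratedFDeriv ℝ n F x‖)

/-- The `m`-th Taylor remainder of `F` at `0`:
`Rem_m F(ψ) = F(ψ) − Σ_{k=0}^m (1/k!) DᵏF(0)[ψ,…,ψ]`. -/
noncomputable def taylorRem {E : Type*} [NormedAddCommGroup E] [NormedSpace ℝ E]
    (m : ℕ) (F : E → ℝ) (ψ : E) : ℝ :=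
  F ψ - ∑ k ∈ Finset.range (m + 1),
    ((k.factorial : ℝ))⁻¹ * iteratedFDeriv ℝ k F 0 (fun _ => ψ)

section helpers
variable {E : Type*} [NormedAddCommGroup E] [NormedSpace ℝ E]

theorem aux_diff {F : E → ℝ} (hF : ContDiff ℝ (⊤ : ℕ∞) F) (n : ℕ) :
    ContDiff ℝ (⊤ : ℕ∞) (iteratedFDeriv ℝ n F) :=
  hF.iteratedFDeriv_right (m := ((⊤ : ℕ∞) : WithTop ℕ∞)) (by exact_mod_cast le_top)

theorem aux_swap {F : E → ℝ} (hF : ContDiff ℝ (⊤ : ℕ∞) F) (n : ℕ) :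
    ∀ (i : Fin n) (x : E) (v : Fin (n + 1) → E),
      iteratedFDeriv ℝ (n + 1) F x (v ∘ Equiv.swap i.castSucc i.succ) =
        iteratedFDeriv ℝ (n + 1) F x v := by
  induction n with
  | zero => intro i; exact i.elim0
  | succ n ih =>
    intro i x v
    induction i using Fin.cases with
    | zero =>
      have key : ∀ w : Fin (n + 1 + 1) → E, iteratedFDeriv ℝ (n + 1 + 1) F x w =
          fderiv ℝ (fderiv ℝ (iteratedFDeriv ℝ n F)) x (w 0) (w 1) (Fin.tail (Fin.tail w)) := by
        intro w
        have hd : DifferentiableAt ℝ (iteratedFDeriv ℝ (n + 1) F) x :=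
          (aux_diff hF (n+1)).differentiable (by simp) x
        have hG : DifferentiableAt ℝ (fderiv ℝ (iteratedFDeriv ℝ n F)) x :=
          ((aux_diff hF n).fderiv_right (m := 1)
            (WithTop.coe_le_coe.mpr (le_top : (1 + 1 : ℕ∞) ≤ ⊤))).differentiable (by simp) x
        rw [hd.iteratedFDeriv_succ_apply_left']
        change fderiv ℝ (fun y => (fderiv ℝ (iteratedFDeriv ℝ n F) y (w 1))
          (Fin.tail (Fin.tail w))) x (w 0) = _
        rw [fderiv_continuousMultilinear_apply_const_apply
          (hG.clm_apply (differentiableAt_const _)),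
          fderiv_clm_apply hG (differentiableAt_const _)]
        simp
      have hs : IsSymmSndFDerivAt ℝ (iteratedFDeriv ℝ n F) x :=
        (aux_diff hF n).contDiffAt.isSymmSndFDerivAt (by
          rw [minSmoothness_of_isRCLikeNormedField]
          exact WithTop.coe_le_coe.mpr (le_top : (2 : ℕ∞) ≤ ⊤))
      rw [key, key]
      have h0 : (v ∘ Equiv.swap (0 : Fin (n+1)).castSucc (0 : Fin (n+1)).succ) 0 = v 1 := by
        simp
      have h1 : (v ∘ Equiv.swap (0 : Fin (n+1)).castSucc (0 : Fin (n+1)).succ) 1 = v 0 := by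
        simp
      have h2 : Fin.tail (Fin.tail (v ∘ Equiv.swap (0 : Fin (n+1)).castSucc (0 : Fin (n+1)).succ))
          = Fin.tail (Fin.tail v) := by
        funext k
        simp only [Fin.tail, Function.comp]
        rw [Equiv.swap_apply_of_ne_of_ne]
        · simp [Fin.ext_iff]
        · simp [Fin.ext_iff]
      rw [h0, h1, h2, hs.eq]
    | succ j =>
      have hd : DifferentiableAt ℝ (iteratedFDeriv ℝ (n + 1) F) x :=
        (aux_diff hF (n+1)).differentiable (by simp) x
      rw [hd.iteratedFDeriv_succ_apply_left', hd.iteratedFDeriv_succ_apply_left']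
      have h0 : (v ∘ Equiv.swap j.succ.castSucc j.succ.succ) 0 = v 0 := by
        simp only [Function.comp]
        rw [Equiv.swap_apply_of_ne_of_ne]
        · simp [Fin.ext_iff]
        · simp [Fin.ext_iff]
      have h2 : Fin.tail (v ∘ Equiv.swap j.succ.castSucc j.succ.succ)
          = Fin.tail v ∘ Equiv.swap j.castSucc j.succ := by
        funext k
        simp only [Fin.tail, Function.comp]
        congr 1
        simp only [Equiv.swap_apply_def, Fin.ext_iff]
        split_ifs <;> simp_all
      rw [h0, h2]
      simp only [ih]

theorem aux_perm {F : E → ℝ} (hF : ContDiff ℝ (⊤ : ℕ∞) F) (n : ℕ) (x : E)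
    (σ : Equiv.Perm (Fin n)) :
    ∀ v : Fin n → E, iteratedFDeriv ℝ n F x (v ∘ σ) = iteratedFDeriv ℝ n F x v := by
  cases n with
  | zero => intro v; congr 1; exact Subsingleton.elim _ _
  | succ n =>
    have hσ : σ ∈ Submonoid.closure
        (Set.range fun i : Fin n ↦ Equiv.swap i.castSucc i.succ) := by
      rw [Equiv.Perm.mclosure_swap_castSucc_succ]; trivial
    induction hσ using Submonoid.closure_induction with
    | mem y hy =>
      obtain ⟨i, rfl⟩ := hy
      exact aux_swap hF n i x
    | one => intro v; rfl
    | mul a b _ _ ha hb =>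
      intro v
      have : v ∘ ⇑(a * b) = (v ∘ a) ∘ b := rfl
      rw [this, hb, ha]

/-- Taylor polynomial series. -/
noncomputable def tSer (m : ℕ) (F : E → ℝ) : FormalMultilinearSeries ℝ E ℝ := fun k =>
  if k < m + 1 then ((k.factorial : ℝ))⁻¹ • iteratedFDeriv ℝ k F 0 else 0

noncomputable def tPol (m : ℕ) (F : E → ℝ) (ψ : E) : ℝ :=
  ∑ k ∈ Finset.range (m + 1), ((k.factorial : ℝ))⁻¹ * iteratedFDeriv ℝ k F 0 (fun _ => ψ)

theorem tPol_series (m : ℕ) (F : E → ℝ) :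
    HasFiniteFPowerSeriesOnBall (tPol m F) (tSer m F) 0 (m + 1) ⊤ := by
  apply HasFiniteFPowerSeriesOnBall.mk'
  · intro k hk
    simp [tSer, not_lt.mpr hk]
  · simp
  · intro y _
    rw [zero_add, tPol]
    refine Finset.sum_congr rfl fun k hk => ?_
    simp [tSer, Finset.mem_range.mp hk]

theorem tPol_series' (m : ℕ) (F : E → ℝ) (y : E) :
    HasFiniteFPowerSeriesOnBall (tPol m F) ((tSer m F).changeOrigin y) y (m + 1) ⊤ := by
  have := (tPol_series m F).changeOrigin (y := y) (by simp)
  simpa using this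

theorem tPol_contDiff (m : ℕ) (F : E → ℝ) : ContDiff ℝ (⊤ : ℕ∞) (tPol m F) := by
  rw [contDiff_iff_contDiffAt]
  intro y
  exact (tPol_series' m F y).toHasFPowerSeriesOnBall.analyticAt.contDiffAt

theorem tPol_high (m : ℕ) (F : E → ℝ) (y : E) {n : ℕ} (hn : m + 1 ≤ n) :
    iteratedFDeriv ℝ n (tPol m F) y = 0 := by
  ext v
  rw [(tPol_series' m F y).toHasFPowerSeriesOnBall.iteratedFDeriv_eq_sum_of_completeSpace,
    (tPol_series' m F y).finite n hn]
  simp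

theorem tPol_low (m : ℕ) {F : E → ℝ} (hF : ContDiff ℝ (⊤ : ℕ∞) F) {n : ℕ} (hn : n < m + 1) :
    iteratedFDeriv ℝ n (tPol m F) 0 = iteratedFDeriv ℝ n F 0 := by
  ext v
  rw [(tPol_series m F).toHasFPowerSeriesOnBall.iteratedFDeriv_eq_sum_of_completeSpace]
  have : ∀ σ : Equiv.Perm (Fin n), tSer m F n (fun i => v (σ i)) =
      ((n.factorial : ℝ))⁻¹ * iteratedFDeriv ℝ n F 0 v := by
    intro σ
    rw [← aux_perm hF n 0 σ v]
    simp only [tSer, if_pos hn]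
    rfl
  simp only [this, Finset.sum_const, Finset.card_univ, Fintype.card_perm, Fintype.card_fin,
    nsmul_eq_mul]
  rw [mul_inv_cancel_left₀]
  exact_mod_cast n.factorial_ne_zero

theorem rem_deriv (m : ℕ) {F : E → ℝ} (hF : ContDiff ℝ (⊤ : ℕ∞) F) (n : ℕ) (y : E) :
    iteratedFDeriv ℝ n (taylorRem m F) y =
      iteratedFDeriv ℝ n F y - iteratedFDeriv ℝ n (tPol m F) y := by
  have h1 : taylorRem m F = F - tPol m F := rfl
  have hn : ((n : ℕ∞) : WithTop ℕ∞) ≤ ((⊤ : ℕ∞) : WithTop ℕ∞) := by exact_mod_cast le_top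
  rw [h1, iteratedFDeriv_sub_apply (hF.of_le hn).contDiffAt
    ((tPol_contDiff m F).of_le hn).contDiffAt]

theorem rem_contDiff (m : ℕ) {F : E → ℝ} (hF : ContDiff ℝ (⊤ : ℕ∞) F) :
    ContDiff ℝ (⊤ : ℕ∞) (taylorRem m F) := hF.sub (tPol_contDiff m F)

theorem rem_bound (m : ℕ) {F : E → ℝ} (hF : ContDiff ℝ (⊤ : ℕ∞) F) (φ : E) (M : ℝ)
    (hM : ∀ t ∈ Set.Icc (0 : ℝ) 1, ‖iteratedFDeriv ℝ (m + 1) F (t • φ)‖ ≤ M) (j : ℕ) :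
    ∀ n, n + j = m + 1 → ∀ t ∈ Set.Icc (0 : ℝ) 1,
      ‖iteratedFDeriv ℝ n (taylorRem m F) (t • φ)‖ ≤ t ^ j * (‖φ‖ ^ j / j.factorial * M) := by
  induction j with
  | zero =>
    intro n hn t ht
    obtain rfl : n = m + 1 := by omega
    rw [rem_deriv m hF, tPol_high m F _ le_rfl]
    simpa using hM t ht
  | succ j ih =>
    intro n hn
    have hd : Differentiable ℝ (iteratedFDeriv ℝ n (taylorRem m F)) :=
      (aux_diff (rem_contDiff m hF) n).differentiable (by simp)
    have hder : ∀ t : ℝ, HasDerivAt (fun t : ℝ => iteratedFDeriv ℝ n (taylorRem m F) (t • φ))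
        (fderiv ℝ (iteratedFDeriv ℝ n (taylorRem m F)) (t • φ) φ) t := by
      intro t
      have h1 : HasDerivAt (fun t : ℝ => t • φ) φ t := by
        simpa using (hasDerivAt_id t).smul_const φ
      exact (hd (t • φ)).hasFDerivAt.comp_hasDerivAt t h1
    apply image_norm_le_of_norm_deriv_right_le_deriv_boundary
      (B := fun t => t ^ (j + 1) * (‖φ‖ ^ (j + 1) / (j + 1).factorial * M))
      (B' := fun t => (((j + 1 : ℕ) : ℝ) * t ^ j) * (‖φ‖ ^ (j + 1) / (j + 1).factorial * M))
      (fun t _ => (hder t).continuousAt.continuousWithinAt)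
      (fun t _ => (hder t).hasDerivWithinAt)
    · simp only [zero_smul]
      rw [rem_deriv m hF, tPol_low m hF (by omega)]
      simp
    · intro t
      exact (hasDerivAt_pow (j + 1) t).mul_const _
    · intro t ht
      have h2 := ih (n + 1) (by omega) t ⟨ht.1, ht.2.le⟩
      calc _ ≤ ‖fderiv ℝ (iteratedFDeriv ℝ n (taylorRem m F)) (t • φ)‖ * ‖φ‖ :=
            ContinuousLinearMap.le_opNorm _ _
        _ ≤ (t ^ j * (‖φ‖ ^ j / j.factorial * M)) * ‖φ‖ := by
            rw [norm_fderiv_iteratedFDeriv]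
            gcongr
        _ = _ := by
            rw [Nat.factorial_succ]
            push_cast
            have : (j.factorial : ℝ) ≠ 0 := by exact_mod_cast j.factorial_ne_zero
            field_simp
            ring

end helpers

/-- For a Banach space `E`, an infinitely Fréchet differentiable `F : E → ℝ`, `m ∈ ℕ`,
`h > 0` and `φ ∈ E`, the Taylor remainder satisfies (in `[0,∞]`):
`‖Rem_m F‖_{h;φ} ≤ (1 + ‖φ‖/h)^{m+1} · sup_{t∈[0,1]} Σ_{n=m+1}^∞ (hⁿ/n!)‖DⁿF(tφ)‖`. -/
theorem stmt11 {E : Type*} [NormedAddCommGroup E] [NormedSpace ℝ E] [CompleteSpace E]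
    (F : E → ℝ) (hF : ContDiff ℝ (⊤ : ℕ∞) F) (m : ℕ) (h : ℝ) (hh : 0 < h) (φ : E) :
    seriesNorm h (taylorRem m F) φ ≤
      ENNReal.ofReal ((1 + ‖φ‖ / h) ^ (m + 1)) *
        ⨆ t ∈ Set.Icc (0 : ℝ) 1,
          ∑' n : ℕ, ENNReal.ofReal (h ^ (n + m + 1) / (n + m + 1).factorial *
            ‖iteratedFDeriv ℝ (n + m + 1) F (t • φ)‖) := by
  set S : ℝ≥0∞ := ⨆ t ∈ Set.Icc (0 : ℝ) 1,
          ∑' n : ℕ, ENNReal.ofReal (h ^ (n + m + 1) / (n + m + 1).factorial *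
            ‖iteratedFDeriv ℝ (n + m + 1) F (t • φ)‖) with hS
  have hx : 0 ≤ ‖φ‖ / h := by positivity
  have hSt : ∀ t ∈ Set.Icc (0 : ℝ) 1,
      ∑' n : ℕ, ENNReal.ofReal (h ^ (n + m + 1) / (n + m + 1).factorial *
            ‖iteratedFDeriv ℝ (n + m + 1) F (t • φ)‖) ≤ S := fun t ht =>
    le_iSup₂ (f := fun (t : ℝ) (_ : t ∈ Set.Icc (0 : ℝ) 1) =>
      ∑' n : ℕ, ENNReal.ofReal (h ^ (n + m + 1) / (n + m + 1).factorial *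
            ‖iteratedFDeriv ℝ (n + m + 1) F (t • φ)‖)) t ht
  clear_value S
  by_cases hT : S = ⊤
  · rw [hT, ENNReal.mul_top]
    · exact le_top
    · have : 0 < (1 + ‖φ‖ / h) ^ (m + 1) := by positivity
      simpa using this
  have hfac : (0 : ℝ) < (m + 1).factorial := by exact_mod_cast (m + 1).factorial_pos
  have hM : ∀ t ∈ Set.Icc (0 : ℝ) 1, ‖iteratedFDeriv ℝ (m + 1) F (t • φ)‖ ≤
      S.toReal * ((m + 1).factorial / h ^ (m + 1)) := by
    intro t ht
    have h1 := (ENNReal.le_tsum 0).trans (hSt t ht)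
    rw [zero_add, ENNReal.ofReal_le_iff_le_toReal hT] at h1
    have : 0 < h ^ (m + 1) := by positivity
    calc _ = (h ^ (m + 1) / (m + 1).factorial * ‖iteratedFDeriv ℝ (m + 1) F (t • φ)‖) *
          ((m + 1).factorial / h ^ (m + 1)) := by field_simp
      _ ≤ _ := by gcongr
  have hlow : ∀ n ∈ Finset.range (m + 1),
      ENNReal.ofReal (h ^ n / n.factorial * ‖iteratedFDeriv ℝ n (taylorRem m F) φ‖) ≤
        ENNReal.ofReal ((‖φ‖ / h) ^ (m + 1 - n) * (m + 1).choose n) * S := by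
    intro n hn
    have hn' : n < m + 1 := Finset.mem_range.mp hn
    have hb := rem_bound m hF φ _ hM (m + 1 - n) n (by omega) 1 (by simp)
    rw [one_smul, one_pow, one_mul] at hb
    rw [← ENNReal.ofReal_toReal hT, ← ENNReal.ofReal_mul (by positivity)]
    apply ENNReal.ofReal_le_ofReal
    calc _ ≤ h ^ n / n.factorial * (‖φ‖ ^ (m + 1 - n) / (m + 1 - n).factorial *
          (S.toReal * ((m + 1).factorial / h ^ (m + 1)))) := by gcongr
      _ = _ := by
        rw [Nat.cast_choose ℝ hn'.le, div_pow]
        have e : h ^ (m + 1) = h ^ n * h ^ (m + 1 - n) := by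
          rw [← pow_add]; congr 1; omega
        have : (n.factorial : ℝ) ≠ 0 := by exact_mod_cast n.factorial_ne_zero
        have : ((m + 1 - n).factorial : ℝ) ≠ 0 := by
          exact_mod_cast (m + 1 - n).factorial_ne_zero
        rw [e]
        field_simp
  have hhigh : ∑' n : ℕ, ENNReal.ofReal (h ^ (n + (m + 1)) / (n + (m + 1)).factorial *
      ‖iteratedFDeriv ℝ (n + (m + 1)) (taylorRem m F) φ‖) ≤ S := by
    refine le_trans (le_of_eq ?_) (hSt 1 (by simp))
    refine tsum_congr fun n => ?_
    rw [rem_deriv m hF, tPol_high m F _ (by omega), sub_zero, one_smul, ← add_assoc]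
  have hpow : ENNReal.ofReal ((1 + ‖φ‖ / h) ^ (m + 1)) =
      (∑ n ∈ Finset.range (m + 1),
        ENNReal.ofReal ((‖φ‖ / h) ^ (m + 1 - n) * (m + 1).choose n)) + 1 := by
    rw [add_pow, Finset.sum_range_succ, ENNReal.ofReal_add
      (Finset.sum_nonneg fun i _ => by positivity) (by simp),
      ENNReal.ofReal_sum_of_nonneg (fun i _ => by positivity)]
    simp
  have hsplit : seriesNorm h (taylorRem m F) φ =
      (∑ n ∈ Finset.range (m + 1),
        ENNReal.ofReal (h ^ n / n.factorial * ‖iteratedFDeriv ℝ n (taylorRem m F) φ‖)) +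
      ∑' n : ℕ, ENNReal.ofReal (h ^ (n + (m + 1)) / (n + (m + 1)).factorial *
        ‖iteratedFDeriv ℝ (n + (m + 1)) (taylorRem m F) φ‖) := by
    unfold seriesNorm
    generalize hf : (fun n : ℕ => ENNReal.ofReal
      (h ^ n / n.factorial * ‖iteratedFDeriv ℝ n (taylorRem m F) φ‖)) = f
    have hf' : ∀ n : ℕ, ENNReal.ofReal
      (h ^ n / n.factorial * ‖iteratedFDeriv ℝ n (taylorRem m F) φ‖) = f n := fun n => by
      rw [← hf]
    simp only [hf']
    exact (Summable.sum_add_tsum_nat_add' (f := f) (k := m + 1) ENNReal.summable).symm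
  rw [hsplit, hpow, add_mul, one_mul, Finset.sum_mul]
  exact add_le_add (Finset.sum_le_sum hlow) hhigh
end

section
/- For every integer n ≥ 2: Σ_τ ∏_{i=1}^{n} (d_i(τ) − 1)! ≤ 4^{n−1}·(n−2)!, where the sum ranges over all trees τ on the vertex set {1,…,n} (simple graphs on {1,…,n} that are connected and acyclic) and d_i(τ) denotes the degree of vertex i in τ. -/
open scoped Classical

/-- degree as `ncard` -/
theorem aux_degree {V : Type*} [Fintype V] (τ : SimpleGraph V) (i : V) :
    (τ.neighborSet i).ncard = τ.degree i := by
  rw [Set.ncard_eq_toFinset_card', ← SimpleGraph.card_neighborFinset_eq_degree]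
  rfl

theorem aux_deg_pos {V : Type*} [Fintype V] [Nontrivial V] (τ : SimpleGraph V) (h : τ.IsTree)
    (i : V) : 1 ≤ (τ.neighborSet i).ncard := by
  rw [aux_degree]
  exact h.connected.preconnected.degree_pos_of_nontrivial i

/-- The trees with prescribed degrees `e i + 1`. -/
noncomputable def treesWith (V : Type*) [Fintype V] (e : V → ℕ) : Finset (SimpleGraph V) :=
  Finset.univ.filter (fun τ => τ.IsTree ∧ ∀ i, (τ.neighborSet i).ncard = e i + 1)

theorem mem_treesWith {V : Type*} [Fintype V] (e : V → ℕ) (τ : SimpleGraph V) :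
    τ ∈ treesWith V e ↔ τ.IsTree ∧ ∀ i, (τ.neighborSet i).ncard = e i + 1 := by
  simp [treesWith]

theorem sum_split {V : Type*} [Fintype V] (v : V) (f : V → ℕ) :
    ∑ i, f i = f v + ∑ i : ({v}ᶜ : Set V), f i := by
  rw [Fintype.sum_eq_add_sum_compl v]
  congr 1
  exact Finset.sum_subtype _ (by simp) _

theorem prod_split {V : Type*} [Fintype V] (v : V) (f : V → ℕ) :
    ∏ i, f i = f v * ∏ i : ({v}ᶜ : Set V), f i := by
  rw [Fintype.prod_eq_mul_prod_compl v]
  congr 1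
  exact Finset.prod_subtype _ (by simp) _

theorem only_nbr {V : Type*} [Fintype V] (τ : SimpleGraph V) {v w : V}
    (h1 : (τ.neighborSet v).ncard = 1) (hw : τ.Adj v w) (x : V) : τ.Adj v x ↔ x = w := by
  obtain ⟨a, ha⟩ := Set.ncard_eq_one.1 h1
  have hx : ∀ y, τ.Adj v y ↔ y = a := fun y => by
    rw [← SimpleGraph.mem_neighborSet, ha]; simp
  have := (hx w).1 hw
  subst this
  exact hx x

theorem induce_nbr {V : Type*} [Fintype V] (τ : SimpleGraph V) {v w : V}
    (h1 : (τ.neighborSet v).ncard = 1) (hw : τ.Adj v w) (x : ({v}ᶜ : Set V)) :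
    ((τ.induce ({v}ᶜ : Set V)).neighborSet x).ncard + (if (x : V) = w then 1 else 0)
      = (τ.neighborSet x).ncard := by
  have hN := only_nbr τ h1 hw
  have himg : Subtype.val '' ((τ.induce ({v}ᶜ : Set V)).neighborSet x)
      = τ.neighborSet x \ {v} := by
    ext y
    simp
  have hc := Set.ncard_image_of_injective ((τ.induce ({v}ᶜ : Set V)).neighborSet x)
    Subtype.val_injective
  rw [himg] at hc
  rw [← hc]
  split_ifs with hxw
  · refine Set.ncard_sdiff_singleton_add_one ?_ (Set.toFinite _)
    rw [hxw]; exact hw.symm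
  · rw [Set.sdiff_singleton_eq_self, add_zero]
    intro hv
    exact hxw ((hN x).1 (SimpleGraph.Adj.symm hv))

theorem induce_tree {V : Type*} [Fintype V] (τ : SimpleGraph V) {v : V} (h : τ.IsTree)
    (h1 : (τ.neighborSet v).ncard = 1) : (τ.induce ({v}ᶜ : Set V)).IsTree :=
  ⟨h.connected.induce_compl_singleton_of_degree_eq_one (by rw [← aux_degree]; exact h1),
    h.isAcyclic.induce _⟩

theorem card_base {V : Type*} [Fintype V] (e : V → ℕ) (hV : Fintype.card V = 2) :
    (treesWith V e).card ≤ 1 := by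
  have : Nontrivial V := Fintype.one_lt_card_iff_nontrivial.1 (by omega)
  rw [Finset.card_le_one]
  have key : ∀ τ ∈ treesWith V e, τ = ⊤ := by
    intro τ hτ
    rw [mem_treesWith] at hτ
    ext a b
    simp only [SimpleGraph.top_adj]
    refine ⟨fun h => h.ne, fun hab => ?_⟩
    obtain ⟨c, hc⟩ := hτ.1.connected.preconnected.exists_adj_of_nontrivial a
    have : c = b := by
      by_contra hcb
      have h3 : ({a, b, c} : Finset V).card = 3 := by
        rw [Finset.card_eq_three]
        exact ⟨a, b, c, hab, hc.ne, fun h => hcb h.symm, rfl⟩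
      have := Finset.card_le_univ ({a, b, c} : Finset V)
      omega
    rwa [← this]
  intro a ha b hb
  rw [key a ha, key b hb]

theorem card_treesWith (m : ℕ) : ∀ (V : Type) [Fintype V] (e : V → ℕ),
    Fintype.card V = m + 2 → ∑ i, e i = m →
    (treesWith V e).card * ∏ i, Nat.factorial (e i) ≤ Nat.factorial m := by
  induction m with
  | zero =>
    intro V _ e hV he
    have h0 : ∀ i, e i = 0 := by simpa using he
    simpa [h0] using card_base e hV
  | succ m ih =>
    intro V _ e hV he
    obtain ⟨v, hv⟩ : ∃ v, e v = 0 := by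
      by_contra! hcon
      have : ∑ i : V, 1 ≤ ∑ i, e i := Finset.sum_le_sum fun i _ => Nat.one_le_iff_ne_zero.2 (hcon i)
      simp at this
      omega
    have : Nontrivial V := Fintype.one_lt_card_iff_nontrivial.1 (by omega)
    have hcardV' : Fintype.card ({v}ᶜ : Set V) = m + 2 := by
      rw [Fintype.card_compl_set]; simp [hV]
    have : Nontrivial ({v}ᶜ : Set V) := Fintype.one_lt_card_iff_nontrivial.1 (by omega)
    have hcov : treesWith V e ⊆
        Finset.univ.biUnion (fun w => (treesWith V e).filter (fun τ => τ.Adj v w)) := by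
      intro τ hτ
      obtain ⟨w, hw⟩ :=
        ((mem_treesWith e τ).1 hτ).1.connected.preconnected.exists_adj_of_nontrivial v
      simp only [Finset.mem_biUnion, Finset.mem_filter, Finset.mem_univ, true_and]
      exact ⟨w, hτ, hw⟩
    have hw : ∀ w, ((treesWith V e).filter (fun τ => τ.Adj v w)).card
        * ∏ i, Nat.factorial (e i) ≤ e w * Nat.factorial m := by
      intro w
      by_cases hne : ((treesWith V e).filter (fun τ => τ.Adj v w)) = ∅
      · simp [hne]
      obtain ⟨τ₀, hτ₀⟩ := Finset.nonempty_iff_ne_empty.2 hne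
      rw [Finset.mem_filter, mem_treesWith] at hτ₀
      have hwv : w ∈ ({v}ᶜ : Set V) := by simpa using hτ₀.2.ne.symm
      have hd0 : (τ₀.neighborSet v).ncard = 1 := by rw [hτ₀.1.2, hv]
      have hew : 1 ≤ e w := by
        have h1 := aux_deg_pos _ (induce_tree τ₀ hτ₀.1.1 hd0) ⟨w, hwv⟩
        have h2 := induce_nbr τ₀ hd0 hτ₀.2 ⟨w, hwv⟩
        simp only [if_true] at h2
        rw [hτ₀.1.2 w] at h2
        omega
      set e' : ({v}ᶜ : Set V) → ℕ := fun x => e x - (if (x : V) = w then 1 else 0) with he'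
      have hcard : ((treesWith V e).filter (fun τ => τ.Adj v w)).card
          ≤ (treesWith _ e').card := by
        refine Finset.card_le_card_of_injOn (fun τ => τ.induce ({v}ᶜ : Set V)) ?_ ?_
        · intro τ hτ
          rw [Finset.mem_coe, Finset.mem_filter, mem_treesWith] at hτ
          have hd : (τ.neighborSet v).ncard = 1 := by rw [hτ.1.2, hv]
          rw [Finset.mem_coe, mem_treesWith]
          refine ⟨induce_tree τ hτ.1.1 hd, fun x => ?_⟩
          have h2 := induce_nbr τ hd hτ.2 x
          rw [hτ.1.2] at h2
          simp only [he']
          split_ifs at h2 ⊢ with hx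
          · rw [hx] at h2 ⊢; omega
          · omega
        · intro τ hτ σ hσ hEq
          rw [Finset.mem_coe, Finset.mem_filter, mem_treesWith] at hτ hσ
          have hN := only_nbr τ (by rw [hτ.1.2, hv]) hτ.2
          have hM := only_nbr σ (by rw [hσ.1.2, hv]) hσ.2
          ext a b
          by_cases ha : a = v
          · subst ha; rw [hN, hM]
          by_cases hb : b = v
          · subst hb; rw [τ.adj_comm, σ.adj_comm, hN, hM]
          have := congrArg (fun G : SimpleGraph ({v}ᶜ : Set V) => G.Adj ⟨a, ha⟩ ⟨b, hb⟩) hEq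
          simpa using this
      have hsum := sum_split v e
      have hs1 := sum_split (⟨w, hwv⟩ : ({v}ᶜ : Set V)) (fun x => e x)
      have hs2 := sum_split (⟨w, hwv⟩ : ({v}ᶜ : Set V)) e'
      have hp0 := prod_split v (fun x => Nat.factorial (e x))
      have hp1 := prod_split (⟨w, hwv⟩ : ({v}ᶜ : Set V)) (fun x => Nat.factorial (e x))
      have hp2 := prod_split (⟨w, hwv⟩ : ({v}ᶜ : Set V)) (fun x => Nat.factorial (e' x))
      have hew' : e' ⟨w, hwv⟩ = e w - 1 := by simp [he']
      have hrest : ∀ y : ({(⟨w, hwv⟩ : ({v}ᶜ : Set V))}ᶜ : Set ({v}ᶜ : Set V)),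
          e' y = e (y : ({v}ᶜ : Set V)) := by
        intro y
        have : ((y : ({v}ᶜ : Set V)) : V) ≠ w := fun h => y.2 (Subtype.ext h)
        simp [he', this]
      simp only [hrest, hew'] at hs2 hp2
      dsimp only at hs1 hp1
      have hse' : ∑ x, e' x = m := by
        rw [hs2]; linarith [he, hv, hs1, hsum, Nat.sub_add_cancel hew]
      have hIH := ih _ e' hcardV' hse'
      have hprod : ∏ i, Nat.factorial (e i) = e w * ∏ x, Nat.factorial (e' x) := by
        rw [hp0, hp1, hp2, hv, Nat.factorial_zero, one_mul, ← mul_assoc,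
          Nat.mul_factorial_pred (by omega)]
      calc _ ≤ (treesWith _ e').card * (e w * ∏ x, Nat.factorial (e' x)) := by
            rw [hprod]; exact Nat.mul_le_mul_right _ hcard
        _ = e w * ((treesWith _ e').card * ∏ x, Nat.factorial (e' x)) := by ring
        _ ≤ _ := Nat.mul_le_mul_left _ hIH
    calc (treesWith V e).card * ∏ i, Nat.factorial (e i)
        ≤ (∑ w, ((treesWith V e).filter (fun τ => τ.Adj v w)).card)
            * ∏ i, Nat.factorial (e i) :=
          Nat.mul_le_mul_right _ ((Finset.card_le_card hcov).trans Finset.card_biUnion_le)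
      _ = ∑ w, ((treesWith V e).filter (fun τ => τ.Adj v w)).card
            * ∏ i, Nat.factorial (e i) := Finset.sum_mul _ _ _
      _ ≤ ∑ w, e w * Nat.factorial m := Finset.sum_le_sum fun w _ => hw w
      _ = Nat.factorial (m + 1) := by
          rw [← Finset.sum_mul, he, Nat.factorial_succ]

theorem sum_deg {n : ℕ} (hn : 2 ≤ n) (τ : SimpleGraph (Fin n)) (h : τ.IsTree) :
    ∑ i, ((τ.neighborSet i).ncard - 1) = n - 2 := by
  have : Nontrivial (Fin n) := Fin.nontrivial_iff_two_le.2 hn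
  have h1 : ∑ i, ((τ.neighborSet i).ncard - 1) + ∑ i : Fin n, 1
      = ∑ i, (τ.neighborSet i).ncard := by
    rw [← Finset.sum_add_distrib]
    exact Finset.sum_congr rfl fun i _ => Nat.sub_add_cancel (aux_deg_pos τ h i)
  simp only [aux_degree] at h1 ⊢
  rw [τ.sum_degrees_eq_twice_card_edges] at h1
  have h2 := h.card_edgeFinset
  simp at h1 h2
  omega

/-- For every `n ≥ 2`, summing over all trees `τ` on the vertex set `{1,…,n}`:
`Σ_τ Π_i (d_i(τ) − 1)! ≤ 4^{n−1} (n−2)!`, where `d_i(τ)` is the degree of vertex `i`. -/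
theorem stmt13 (n : ℕ) (hn : 2 ≤ n) :
    ∑ τ ∈ Finset.univ.filter (fun τ : SimpleGraph (Fin n) => τ.IsTree),
        ∏ i : Fin n, Nat.factorial ((τ.neighborSet i).ncard - 1) ≤
      4 ^ (n - 1) * Nat.factorial (n - 2) := by
  have : Nontrivial (Fin n) := Fin.nontrivial_iff_two_le.2 hn
  set A := Finset.finsuppAntidiag (Finset.univ : Finset (Fin n)) (n - 2) with hA
  set F : SimpleGraph (Fin n) → (Fin n →₀ ℕ) := fun τ =>
    Finsupp.equivFunOnFinite.symm (fun i => (τ.neighborSet i).ncard - 1) with hF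
  rw [← Finset.sum_fiberwise_of_maps_to (t := A) (g := F)]
  · have hfib : ∀ f ∈ A,
        ∑ τ ∈ (Finset.univ.filter (fun τ : SimpleGraph (Fin n) => τ.IsTree)).filter
          (fun τ => F τ = f), ∏ i : Fin n, Nat.factorial ((τ.neighborSet i).ncard - 1)
        ≤ Nat.factorial (n - 2) := by
      intro f hf
      have hfs : ∑ i, f i = n - 2 := (Finset.mem_finsuppAntidiag.1 hf).1
      refine le_trans (le_of_eq ?_) (card_treesWith (n - 2) (Fin n) f (by simp; omega) hfs)
      have hset : (Finset.univ.filter (fun τ : SimpleGraph (Fin n) => τ.IsTree)).filter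
          (fun τ => F τ = f) = treesWith (Fin n) f := by
        ext τ
        rw [mem_treesWith, Finset.mem_filter, Finset.mem_filter]
        simp only [Finset.mem_univ, true_and]
        refine and_congr_right fun hτ => ?_
        rw [Finsupp.ext_iff]
        refine forall_congr' fun i => ?_
        have := aux_deg_pos τ hτ i
        simp only [hF, Finsupp.equivFunOnFinite_symm_apply_apply]
        omega
      rw [hset, Finset.sum_congr rfl (g := fun _ => ∏ i, Nat.factorial (f i)), Finset.sum_const,
        smul_eq_mul]
      intro τ hτ
      refine Finset.prod_congr rfl fun i _ => ?_
      rw [((mem_treesWith _ _).1 hτ).2 i, Nat.add_sub_cancel]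
    refine (Finset.sum_le_card_nsmul _ _ _ hfib).trans ?_
    rw [smul_eq_mul]
    refine Nat.mul_le_mul_right _ ?_
    rw [hA, Finset.card_finsuppAntidiag_nat_eq_choose]
    refine (Nat.choose_le_two_pow _ _).trans ?_
    rw [show 4 = 2 ^ 2 by rfl, ← pow_mul]
    refine Nat.pow_le_pow_right (by norm_num) ?_
    simp
    omega
  · intro τ hτ
    rw [hA, Finset.mem_finsuppAntidiag]
    refine ⟨?_, fun _ _ => Finset.mem_univ _⟩
    exact sum_deg hn τ (Finset.mem_filter.1 hτ).2
end

section
/- Let X ⊂ ℝ² be compact, β > 0, and ζ, ζ′ ∈ L¹(X). Define V_ζ : C(X;ℝ) → ℝ on the Banach space of continuous functions with the sup norm by V_ζ(φ) = ∫_X ζ(x)·cos(√β·φ(x)) dx. Then V_ζ and V_{ζ′} are infinitely Fréchet differentiable and for every φ ∈ C(X;ℝ) and every h > 0: ‖V_ζ − V_{ζ′}‖_{h;φ} ≤ e^{√β·h} · ‖ζ − ζ′‖_{L¹(X)}. -/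
open MeasureTheory
open scoped ENNReal

noncomputable section

/-- The sine-Gordon potential `V_ζ(φ) = ∫_X ζ(x) cos(√β φ(x)) dx` as a functional on the
Banach space `C(X, ℝ)` of continuous functions on the compact set `X` with the sup norm;
the integral is taken with respect to Lebesgue measure transported to `X`. -/
def sgV (X : Set E2) (β : ℝ) (ζ : E2 → ℝ) (φ : C(X, ℝ)) : ℝ :=
  ∫ x : X, ζ x * Real.cos (Real.sqrt β * φ x) ∂(volume.comap Subtype.val)

section Helpers

/-- `φ ↦ i √β φ` as a continuous linear map. -/
def sgA (X : Set E2) [CompactSpace X] (b : ℝ) : C(X, ℝ) →L[ℝ] C(X, ℂ) :=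
  LinearMap.mkContinuous
    { toFun := fun φ => ⟨fun x => ((b * φ x : ℝ) : ℂ) * Complex.I, by fun_prop⟩
      map_add' := fun φ ψ => by
        ext x
        simp only [ContinuousMap.coe_mk, ContinuousMap.add_apply]
        push_cast
        ring
      map_smul' := fun c φ => by
        ext x
        simp only [ContinuousMap.coe_mk, ContinuousMap.smul_apply, smul_eq_mul,
          RingHom.id_apply, Complex.real_smul]
        push_cast
        ring } |b| (fun φ => by
      rw [ContinuousMap.norm_le _ (by positivity)]
      intro x
      simp only [LinearMap.coe_mk, AddHom.coe_mk, ContinuousMap.coe_mk, norm_mul, Complex.norm_I,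
        mul_one, Complex.norm_real, Real.norm_eq_abs, abs_mul]
      gcongr
      exact φ.norm_coe_le_norm x)

theorem sgA_apply (X : Set E2) [CompactSpace X] (b : ℝ) (φ : C(X, ℝ)) (x : X) :
    sgA X b φ x = ((b * φ x : ℝ) : ℂ) * Complex.I := rfl

theorem sgA_norm_le (X : Set E2) [CompactSpace X] (b : ℝ) : ‖sgA X b‖ ≤ |b| :=
  LinearMap.mkContinuous_norm_le _ (abs_nonneg _) _

/-- `φ ↦ exp (i √β φ)`. -/
def sgG (X : Set E2) [CompactSpace X] (b : ℝ) (φ : C(X, ℝ)) : C(X, ℂ) :=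
  NormedSpace.exp (sgA X b φ)

theorem sgG_apply (X : Set E2) [CompactSpace X] (b : ℝ) (φ : C(X, ℝ)) (x : X) :
    sgG X b φ x = Complex.exp (((b * φ x : ℝ) : ℂ) * Complex.I) := by
  have h := NormedSpace.map_exp (ContinuousMap.evalAlgHom ℝ ℂ x)
    (continuous_eval_const x) (sgA X b φ)
  rw [← Complex.exp_eq_exp_ℂ] at h
  exact h

theorem sgG_norm_le (X : Set E2) [CompactSpace X] (b : ℝ) (φ : C(X, ℝ)) : ‖sgG X b φ‖ ≤ 1 := by
  rw [ContinuousMap.norm_le _ zero_le_one]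
  intro x
  rw [sgG_apply, Complex.norm_exp_ofReal_mul_I]

theorem sgG_contDiff (X : Set E2) [CompactSpace X] (b : ℝ) (n : WithTop ℕ∞) :
    ContDiff ℝ n (sgG X b) := by
  have h : ContDiff ℝ n (NormedSpace.exp : C(X, ℂ) → C(X, ℂ)) :=
    contDiff_iff_contDiffAt.2 fun x => (NormedSpace.exp_analytic (𝕂 := ℝ) x).contDiffAt
  exact h.comp (sgA X b).contDiff

/-- `f ↦ (v ↦ f * A v)`. -/
def sgB {E R : Type*} [NormedAddCommGroup E] [NormedSpace ℝ E] [NormedCommRing R]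
    [NormedAlgebra ℝ R] (A : E →L[ℝ] R) : R →L[ℝ] (E →L[ℝ] R) :=
  LinearMap.mkContinuous
    { toFun := fun f => (ContinuousLinearMap.mul ℝ R f).comp A
      map_add' := fun f g => by ext; simp
      map_smul' := fun c f => by ext; simp } ‖A‖ (fun f => by
      refine (ContinuousLinearMap.opNorm_comp_le _ _).trans ?_
      rw [mul_comm]
      exact mul_le_mul le_rfl (ContinuousLinearMap.opNorm_mul_apply_le _ _ _)
        (norm_nonneg _) (norm_nonneg _))

theorem sg_exp_iter {E R : Type*} [NormedAddCommGroup E] [NormedSpace ℝ E] [NormedCommRing R]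
    [NormedAlgebra ℝ R] [CompleteSpace R] (A : E →L[ℝ] R)
    (hs : ∀ n : ℕ, ContDiff ℝ n (fun φ => NormedSpace.exp (A φ)))
    (n : ℕ) (φ : E) :
    ‖iteratedFDeriv ℝ n (fun φ => NormedSpace.exp (A φ)) φ‖ ≤
      ‖A‖ ^ n * ‖NormedSpace.exp (A φ)‖ := by
  have hder : fderiv ℝ (fun φ => NormedSpace.exp (A φ)) =
      sgB A ∘ (fun φ => NormedSpace.exp (A φ)) := by
    funext φ
    have h := (hasFDerivAt_exp (𝕂 := ℝ) (x := A φ)).comp φ A.hasFDerivAt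
    have h2 : HasFDerivAt (fun φ => NormedSpace.exp (A φ)) _ φ := h
    rw [h2.fderiv]
    ext v
    simp [sgB]
  induction n with
  | zero => simp
  | succ n ih =>
    rw [← norm_iteratedFDeriv_fderiv, hder, pow_succ', mul_assoc]
    refine ((sgB A).norm_iteratedFDeriv_comp_left (n := n)
      (hs n).contDiffAt le_rfl).trans ?_
    exact mul_le_mul (LinearMap.mkContinuous_norm_le _ (norm_nonneg _) _) ih (norm_nonneg _)
      (norm_nonneg _)

theorem sgG_iter (X : Set E2) [CompactSpace X] (b : ℝ) (n : ℕ) (φ : C(X, ℝ)) :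
    ‖iteratedFDeriv ℝ n (sgG X b) φ‖ ≤ |b| ^ n := by
  refine (sg_exp_iter (sgA X b) (fun n => sgG_contDiff X b n) n φ).trans ?_
  refine (mul_le_mul (pow_le_pow_left₀ (norm_nonneg _) (sgA_norm_le X b) n) (sgG_norm_le X b φ)
    (norm_nonneg _) (by positivity)).trans ?_
  rw [mul_one]

theorem sg_mul_integrable (X : Set E2) [CompactSpace X] (μ : Measure X) (g : X → ℝ)
    (hg : Integrable g μ) (f : C(X, ℝ)) : Integrable (fun x => g x * f x) μ :=
  hg.mul_bdd (c := ‖f‖) f.continuous.aestronglyMeasurable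
    (Filter.Eventually.of_forall fun x => f.norm_coe_le_norm x)

/-- real part as a continuous function. -/
def sgRe (X : Set E2) (f : C(X, ℂ)) : C(X, ℝ) := ⟨fun x => (f x).re, by fun_prop⟩

/-- `f ↦ ∫ g Re f`. -/
def sgL (X : Set E2) [CompactSpace X] (μ : Measure X) (g : X → ℝ)
    (hg : Integrable g μ) : C(X, ℂ) →L[ℝ] ℝ :=
  LinearMap.mkContinuous
    { toFun := fun f => ∫ x, g x * sgRe X f x ∂μ
      map_add' := fun f f' => by
        rw [← integral_add (sg_mul_integrable X μ g hg _) (sg_mul_integrable X μ g hg _)]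
        refine integral_congr_ae (Filter.Eventually.of_forall fun x => ?_)
        simp [sgRe, mul_add]
      map_smul' := fun c f => by
        rw [RingHom.id_apply, smul_eq_mul, ← integral_const_mul]
        refine integral_congr_ae (Filter.Eventually.of_forall fun x => ?_)
        simp [sgRe]
        ring } (∫ x, |g x| ∂μ) (fun f => by
      rw [← integral_mul_const]
      refine norm_integral_le_of_norm_le (hg.abs.mul_const _)
        (Filter.Eventually.of_forall fun x => ?_)
      rw [norm_mul, Real.norm_eq_abs]
      gcongr
      exact (Complex.abs_re_le_norm _).trans (f.norm_coe_le_norm x))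

theorem sgL_norm_le (X : Set E2) [CompactSpace X] (μ : Measure X) (g : X → ℝ)
    (hg : Integrable g μ) : ‖sgL X μ g hg‖ ≤ ∫ x, |g x| ∂μ :=
  LinearMap.mkContinuous_norm_le _ (integral_nonneg fun _ => abs_nonneg _) _

theorem sgV_eq (X : Set E2) [CompactSpace X] (β : ℝ) (ζ : E2 → ℝ)
    (hg : Integrable (fun x : X => ζ x) (volume.comap Subtype.val)) :
    sgV X β ζ = sgL X _ _ hg ∘ sgG X (Real.sqrt β) := by
  funext φ
  change _ = ∫ x, _ ∂_
  refine integral_congr_ae (Filter.Eventually.of_forall fun x => ?_)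
  change _ = ζ x * (sgG X (Real.sqrt β) φ x).re
  rw [sgG_apply, Complex.exp_ofReal_mul_I_re]

end Helpers

/-- For `X ⊂ ℝ²` compact, `β > 0` and `ζ, ζ′ ∈ L¹(X)`, the functionals `V_ζ, V_{ζ′}` on
`C(X, ℝ)` are infinitely Fréchet differentiable and for every `φ ∈ C(X, ℝ)` and `h > 0`:
`‖V_ζ − V_{ζ′}‖_{h;φ} ≤ e^{√β h} ‖ζ − ζ′‖_{L¹(X)}`. -/
theorem stmt14 (X : Set E2) [CompactSpace X] (β : ℝ) (hβ : 0 < β)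
    (ζ ζ' : E2 → ℝ) (hζ : IntegrableOn ζ X volume) (hζ' : IntegrableOn ζ' X volume) :
    ContDiff ℝ (⊤ : ℕ∞) (sgV X β ζ) ∧ ContDiff ℝ (⊤ : ℕ∞) (sgV X β ζ') ∧
      ∀ (φ : C(X, ℝ)) (h : ℝ), 0 < h →
        (∑' n : ℕ, ENNReal.ofReal (h ^ n / n.factorial *
            ‖iteratedFDeriv ℝ n (fun ψ => sgV X β ζ ψ - sgV X β ζ' ψ) φ‖)) ≤
          ENNReal.ofReal (Real.exp (Real.sqrt β * h) * ∫ x in X, |ζ x - ζ' x|) := by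
  have hX : MeasurableSet X := (isCompact_iff_compactSpace.2 inferInstance).measurableSet
  have key : ∀ ξ : E2 → ℝ, IntegrableOn ξ X volume →
      Integrable (fun x : X => ξ x) (volume.comap Subtype.val) := fun ξ hξ =>
    (integrableOn_iff_comap_subtypeVal hX).1 hξ
  have hd : IntegrableOn (fun x => ζ x - ζ' x) X volume := hζ.sub hζ'
  have smooth : ∀ ξ : E2 → ℝ, IntegrableOn ξ X volume →
      ContDiff ℝ (⊤ : ℕ∞) (sgV X β ξ) := fun ξ hξ => by
    rw [sgV_eq X β ξ (key ξ hξ)]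
    exact (sgL X _ _ _).contDiff.comp (sgG_contDiff X _ _)
  refine ⟨smooth ζ hζ, smooth ζ' hζ', fun φ h hh => ?_⟩
  have hsub : (fun ψ => sgV X β ζ ψ - sgV X β ζ' ψ) = sgV X β (fun x => ζ x - ζ' x) := by
    funext ψ
    let c : C(X, ℝ) := ⟨fun x => Real.cos (Real.sqrt β * ψ x), by fun_prop⟩
    have h1 := sg_mul_integrable X _ _ (key ζ hζ) c
    have h2 := sg_mul_integrable X _ _ (key ζ' hζ') c
    refine (integral_sub h1 h2).symm.trans ?_
    refine integral_congr_ae (Filter.Eventually.of_forall fun x => ?_)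
    exact (sub_mul _ _ _).symm
  rw [hsub]
  set I := ∫ x in X, |ζ x - ζ' x| with hI
  have hI0 : 0 ≤ I := integral_nonneg fun _ => abs_nonneg _
  have hIeq : ∫ x : X, |ζ x - ζ' x| ∂(volume.comap Subtype.val) = I :=
    integral_subtype_comap hX (fun x => |ζ x - ζ' x|)
  have hb : ∀ n : ℕ, ‖iteratedFDeriv ℝ n (sgV X β (fun x => ζ x - ζ' x)) φ‖ ≤
      I * Real.sqrt β ^ n := fun n => by
    rw [sgV_eq X β _ (key _ hd)]
    refine ((sgL X _ _ _).norm_iteratedFDeriv_comp_left (n := n)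
      (sgG_contDiff X _ n).contDiffAt le_rfl).trans ?_
    have h1 := sgG_iter X (Real.sqrt β) n φ
    rw [abs_of_nonneg (Real.sqrt_nonneg β)] at h1
    exact mul_le_mul ((sgL_norm_le X _ _ _).trans hIeq.le) h1 (norm_nonneg _) hI0
  have hs : HasSum (fun n : ℕ => (Real.sqrt β * h) ^ n / n.factorial * I)
      (Real.exp (Real.sqrt β * h) * I) := by
    have := NormedSpace.expSeries_div_hasSum_exp (Real.sqrt β * h)
    rw [← Real.exp_eq_exp_ℝ] at this
    exact this.mul_right I
  rw [← hs.tsum_eq, ENNReal.ofReal_tsum_of_nonneg (fun n => by positivity) hs.summable]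
  refine ENNReal.tsum_le_tsum fun n => ENNReal.ofReal_le_ofReal ?_
  calc _ ≤ h ^ n / n.factorial * (I * Real.sqrt β ^ n) := by
        gcongr
        exact hb n
    _ = _ := by rw [mul_pow]; ring

end
end

section
/- Let X be a real random variable on a probability space with characteristic function φ_X, and let r > 0, M > 0. Suppose there is a function F : ℂ → ℂ, holomorphic on an open set containing the closed disc { z : |z| ≤ r }, such that F(t) = φ_X(t) for all real t with |t| ≤ r and |F(z)| ≤ M for all |z| ≤ r. Then for every integer n ≥ 1, E[|X|^{2n}] ≤ 2n·(2n)!·M·r^{−2n}; in particular X has finite moments of all orders. -/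
open MeasureTheory

open Filter Topology Finset in
theorem aux_sum_pow (m i : ℕ) (hi : i ≤ m) (y : ℂ) :
    ∑ k ∈ range (m + 1), ((-1 : ℂ) ^ (m - k) * (m.choose k : ℂ)) * (y + k) ^ i
      = if i = m then (m.factorial : ℂ) else 0 := by
  have h := fwdDiff_iter_eq_sum_shift (1 : ℂ) (fun x : ℂ => x ^ i) m y
  have h2 : ∑ k ∈ range (m + 1), ((-1 : ℂ) ^ (m - k) * (m.choose k : ℂ)) * (y + k) ^ i
      = (fwdDiff (1 : ℂ))^[m] (fun x : ℂ => x ^ i) y := by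
    rw [h]
    refine sum_congr rfl fun k _ => ?_
    simp [zsmul_eq_mul]
  rw [h2]
  split_ifs with him
  · subst him
    rw [fwdDiff_iter_eq_factorial]; rfl
  · rw [fwdDiff_iter_pow_eq_zero_of_lt (lt_of_le_of_ne hi him)]; rfl

open Filter Topology Finset in
theorem aux_tendsto (F : ℂ → ℂ) (hF : AnalyticAt ℂ F 0) (m : ℕ) (y : ℂ) :
    Tendsto (fun h : ℝ => (∑ k ∈ range (m + 1),
        ((-1 : ℂ) ^ (m - k) * (m.choose k : ℂ)) * F (h * (y + k))) / (h : ℂ) ^ m)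
      (𝓝[>] 0) (𝓝 (iteratedDeriv m F 0)) := by
  set p := FormalMultilinearSeries.ofScalars ℂ (fun n ↦ iteratedDeriv n F 0 / (n.factorial : ℂ))
    with hp
  have hO := hF.hasFPowerSeriesAt.isBigO_sub_partialSum_pow (m + 1)
  rw [← hp] at hO
  simp only [zero_add] at hO
  have hPS : ∀ z, p.partialSum (m + 1) z
      = ∑ i ∈ range (m + 1), iteratedDeriv i F 0 / (i.factorial : ℂ) * z ^ i := by
    intro z
    simp [FormalMultilinearSeries.partialSum, hp, mul_comm]
  have hsum : ∀ h : ℝ, ∑ k ∈ range (m + 1),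
        ((-1 : ℂ) ^ (m - k) * (m.choose k : ℂ)) * p.partialSum (m + 1) (h * (y + k))
      = iteratedDeriv m F 0 * (h : ℂ) ^ m := by
    intro h
    simp_rw [hPS, mul_sum]
    rw [sum_comm]
    have : ∀ i ∈ range (m + 1), ∑ k ∈ range (m + 1),
        ((-1 : ℂ) ^ (m - k) * (m.choose k : ℂ)) *
          (iteratedDeriv i F 0 / (i.factorial : ℂ) * (h * (y + k)) ^ i)
        = if i = m then iteratedDeriv m F 0 * (h : ℂ) ^ m else 0 := by
      intro i hi
      have h1 := aux_sum_pow m i (Nat.lt_succ_iff.1 (mem_range.1 hi)) y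
      have : ∑ k ∈ range (m + 1),
        ((-1 : ℂ) ^ (m - k) * (m.choose k : ℂ)) *
          (iteratedDeriv i F 0 / (i.factorial : ℂ) * (h * (y + k)) ^ i)
        = (iteratedDeriv i F 0 / (i.factorial : ℂ) * (h : ℂ) ^ i) * ∑ k ∈ range (m + 1),
          ((-1 : ℂ) ^ (m - k) * (m.choose k : ℂ)) * (y + k) ^ i := by
        rw [mul_sum]
        refine sum_congr rfl fun k _ => ?_
        rw [mul_pow]; ring
      rw [this, h1]
      split_ifs with him
      · subst him
        have : (i.factorial : ℂ) ≠ 0 := by exact_mod_cast i.factorial_ne_zero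
        field_simp
      · simp
    rw [sum_congr rfl this]
    simp
  have hrem : (fun h : ℝ => ∑ k ∈ range (m + 1),
        ((-1 : ℂ) ^ (m - k) * (m.choose k : ℂ)) *
          (F (h * (y + k)) - p.partialSum (m + 1) (h * (y + k))))
      =O[𝓝 0] fun h : ℝ => (h : ℂ) ^ (m + 1) := by
    refine Asymptotics.IsBigO.fun_sum fun k _ => ?_
    refine Asymptotics.IsBigO.const_mul_left ?_ _
    have ht : Tendsto (fun h : ℝ => (h : ℂ) * (y + k)) (𝓝 0) (𝓝 0) := by
      have : Continuous (fun h : ℝ => (h : ℂ) * (y + k)) := by fun_prop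
      simpa using this.tendsto 0
    refine (hO.comp_tendsto ht).trans ?_
    refine Asymptotics.IsBigO.of_bound (‖y + k‖ ^ (m + 1)) (Eventually.of_forall fun h => ?_)
    simp [mul_pow, mul_comm]
  have hlim : Tendsto (fun h : ℝ => (∑ k ∈ range (m + 1),
        ((-1 : ℂ) ^ (m - k) * (m.choose k : ℂ)) *
          (F (h * (y + k)) - p.partialSum (m + 1) (h * (y + k)))) / (h : ℂ) ^ m)
      (𝓝 0) (𝓝 0) := by
    have hlo : (fun h : ℝ => (h : ℂ) ^ (m + 1)) =o[𝓝 0] fun h : ℝ => (h : ℂ) ^ m := by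
      have h1 : (fun x : ℂ => x ^ (m + 1)) =o[𝓝 0] fun x => x ^ m :=
        Asymptotics.isLittleO_pow_pow (Nat.lt_succ_self m)
      have h2 : Tendsto (fun h : ℝ => (h : ℂ)) (𝓝 0) (𝓝 0) := by
        simpa using Complex.continuous_ofReal.tendsto 0
      exact h1.comp_tendsto h2
    exact (hrem.trans_isLittleO hlo).tendsto_div_nhds_zero
  have hfin := (hlim.mono_left (nhdsWithin_le_nhds (s := Set.Ioi (0 : ℝ)))).add_const
    (iteratedDeriv m F 0)
  rw [zero_add] at hfin
  refine hfin.congr' ?_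
  filter_upwards [self_mem_nhdsWithin] with h hh
  have hne : (h : ℂ) ^ m ≠ 0 := pow_ne_zero _ (by exact_mod_cast (ne_of_gt hh))
  simp_rw [mul_sub]
  rw [sum_sub_distrib, hsum]
  field_simp
  ring

open Finset in
theorem aux_expand (n : ℕ) (h x : ℝ) :
    ∑ k ∈ range (2 * n + 1), ((-1 : ℂ) ^ (2 * n - k) * ((2 * n).choose k : ℂ)) *
        Complex.exp (Complex.I * ((h * (-n + k) : ℝ) : ℂ) * (x : ℂ))
      = (-1) ^ n * (((2 * Real.sin (h * x / 2)) ^ (2 * n) : ℝ) : ℂ) := by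
  set w : ℂ := Complex.I * ((h * x / 2 : ℝ) : ℂ) with hw
  have h1 : (Complex.exp w + -Complex.exp (-w)) ^ (2 * n)
      = (-1) ^ n * (((2 * Real.sin (h * x / 2)) ^ (2 * n) : ℝ) : ℂ) := by
    have : Complex.exp w + -Complex.exp (-w) = 2 * Complex.sin ((h * x / 2 : ℝ) : ℂ) * Complex.I := by
      rw [Complex.sin, hw]
      have e1 : -((h * x / 2 : ℝ) : ℂ) * Complex.I = -(Complex.I * ((h * x / 2 : ℝ) : ℂ)) := by ring
      have e2 : ((h * x / 2 : ℝ) : ℂ) * Complex.I = (Complex.I * ((h * x / 2 : ℝ) : ℂ)) := by ring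
      rw [e1, e2]
      linear_combination -(Complex.exp (-(Complex.I * ((h * x / 2 : ℝ) : ℂ))) -
        Complex.exp ((Complex.I * ((h * x / 2 : ℝ) : ℂ)))) * Complex.I_mul_I
    rw [this, mul_pow, pow_mul Complex.I, Complex.I_sq]
    push_cast
    ring
  rw [← h1, add_pow]
  refine sum_congr rfl fun k hk => ?_
  have hk' : k ≤ 2 * n := Nat.lt_succ_iff.1 (mem_range.1 hk)
  rw [neg_pow (Complex.exp (-w)), ← Complex.exp_nat_mul, ← Complex.exp_nat_mul]
  have : Complex.exp (Complex.I * ((h * (-n + k) : ℝ) : ℂ) * (x : ℂ))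
      = Complex.exp (k * w) * Complex.exp (((2 * n - k : ℕ) : ℂ) * -w) := by
    rw [← Complex.exp_add]
    congr 1
    rw [hw, Nat.cast_sub hk']
    push_cast
    ring
  rw [this]
  ring

theorem aux_int_exp {Ω : Type*} [MeasurableSpace Ω] (μ : Measure Ω) [IsProbabilityMeasure μ]
    (X : Ω → ℝ) (hX : Measurable X) (t : ℝ) :
    Integrable (fun ω => Complex.exp (Complex.I * (t : ℂ) * (X ω : ℂ))) μ := by
  refine Integrable.of_bound (C := 1) ?_ ?_
  · exact (by fun_prop : Measurable fun ω => Complex.exp (Complex.I * (t : ℂ) * (X ω : ℂ))).aestronglyMeasurable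
  · refine Filter.Eventually.of_forall fun ω => ?_
    have : Complex.I * (t : ℂ) * (X ω : ℂ) = ((t * X ω : ℝ) : ℂ) * Complex.I := by
      push_cast; ring
    rw [this, Complex.norm_exp_ofReal_mul_I]

open Filter Topology Finset in
theorem aux_main {Ω : Type*} [MeasurableSpace Ω] (μ : Measure Ω) [IsProbabilityMeasure μ]
    (X : Ω → ℝ) (hX : Measurable X) (r : ℝ) (hr : 0 < r)
    (F : ℂ → ℂ) (hF : AnalyticAt ℂ F 0)
    (hFchar : ∀ t : ℝ, |t| ≤ r →
      F t = ∫ ω, Complex.exp (Complex.I * (t : ℂ) * (X ω : ℂ)) ∂μ) (n : ℕ) :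
    ∫⁻ ω, ENNReal.ofReal (|X ω| ^ (2 * n)) ∂μ
      ≤ ENNReal.ofReal ‖iteratedDeriv (2 * n) F 0‖ := by
  let g : ℝ → Ω → ℝ := fun h ω => (2 * Real.sin (h * X ω / 2) / h) ^ (2 * n)
  have hg0 : ∀ h ω, 0 ≤ g h ω := fun h ω => (even_two_mul n).pow_nonneg _
  have hgm : ∀ h, Measurable (g h) := fun h => by
    have : Measurable fun ω => Real.sin (h * X ω / 2) :=
      Real.measurable_sin.comp ((hX.const_mul h).div_const 2)
    exact ((this.const_mul 2).div_const h).pow_const _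
  -- pointwise limit
  have hpt : ∀ ω, Tendsto (fun h : ℝ => ENNReal.ofReal (g h ω)) (𝓝[>] 0)
      (𝓝 (ENNReal.ofReal (|X ω| ^ (2 * n)))) := by
    intro ω
    refine (ENNReal.continuous_ofReal.tendsto _).comp ?_
    have hd : HasDerivAt (fun h : ℝ => 2 * Real.sin (h * X ω / 2)) (X ω) 0 := by
      have h1 : HasDerivAt (fun h : ℝ => h * X ω / 2) (X ω / 2) 0 := by
        simpa using ((hasDerivAt_id (0 : ℝ)).mul_const (X ω)).div_const 2
      have h2 := (h1.sin).const_mul 2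
      exact h2.congr_deriv (by simp [mul_div_cancel₀])
    have hs := hd.tendsto_slope_zero_right
    rw [(even_two_mul n).pow_abs]
    refine (hs.pow (2 * n)).congr fun h => ?_
    simp [g, div_eq_inv_mul]
  -- the integral
  have hint : ∀ᶠ h : ℝ in 𝓝[>] 0, ∫⁻ ω, ENNReal.ofReal (g h ω) ∂μ
      = ENNReal.ofReal ‖(∑ k ∈ range (2 * n + 1),
        ((-1 : ℂ) ^ (2 * n - k) * ((2 * n).choose k : ℂ)) * F (h * (-n + k))) /
          (h : ℂ) ^ (2 * n)‖ := by
    have hsmall : ∀ᶠ h : ℝ in 𝓝[>] 0, h * n < r := by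
      have : Tendsto (fun h : ℝ => h * n) (𝓝 0) (𝓝 0) := by
        have : Continuous (fun h : ℝ => h * n) := by fun_prop
        simpa using this.tendsto 0
      exact (this.mono_left nhdsWithin_le_nhds).eventually_lt_const hr
    filter_upwards [self_mem_nhdsWithin, hsmall] with h hh hhr
    have hh : 0 < h := hh
    have hS : ∑ k ∈ range (2 * n + 1),
        ((-1 : ℂ) ^ (2 * n - k) * ((2 * n).choose k : ℂ)) * F (h * (-n + k))
        = (-1) ^ n * ((∫ ω, (2 * Real.sin (h * X ω / 2)) ^ (2 * n) ∂μ : ℝ) : ℂ) := by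
      rw [← integral_complex_ofReal, ← integral_const_mul]
      simp_rw [← aux_expand n h]
      rw [integral_finsetSum _ fun k _ => (aux_int_exp μ X hX _).const_mul _]
      refine sum_congr rfl fun k hk => ?_
      have hk' : k ≤ 2 * n := Nat.lt_succ_iff.1 (mem_range.1 hk)
      have hk2 : (k : ℝ) ≤ 2 * n := by exact_mod_cast hk'
      rw [integral_const_mul, ← hFchar]
      · push_cast; rfl
      · rw [abs_mul, abs_of_pos hh]
        refine le_trans (mul_le_mul_of_nonneg_left ?_ hh.le) hhr.le
        rw [abs_le]
        constructor <;> linarith [(Nat.cast_nonneg k : (0 : ℝ) ≤ k)]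
    rw [hS, ← ofReal_integral_eq_lintegral_ofReal]
    · congr 1
      have : ∀ ω, g h ω = (2 * Real.sin (h * X ω / 2)) ^ (2 * n) / h ^ (2 * n) := fun ω => by
        simp only [g, div_pow]
      simp_rw [this]
      rw [integral_div, norm_div, norm_mul, norm_pow, norm_neg, norm_one, one_pow, one_mul,
        Complex.norm_real, norm_pow, Complex.norm_real, Real.norm_of_nonneg hh.le,
        Real.norm_of_nonneg (integral_nonneg fun ω => (even_two_mul n).pow_nonneg _)]
    · refine Integrable.of_bound (C := (2 / h) ^ (2 * n)) (hgm h).aestronglyMeasurable ?_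
      refine Eventually.of_forall fun ω => ?_
      simp only [g]
      rw [norm_pow]
      refine pow_le_pow_left₀ (norm_nonneg _) ?_ _
      rw [norm_div, Real.norm_of_nonneg hh.le, norm_mul]
      gcongr
      have := Real.abs_sin_le_one (h * X ω / 2)
      simp only [Real.norm_eq_abs, abs_two]
      linarith
    · exact Eventually.of_forall (hg0 h)
  have hlim : Tendsto (fun h : ℝ => ∫⁻ ω, ENNReal.ofReal (g h ω) ∂μ) (𝓝[>] 0)
      (𝓝 (ENNReal.ofReal ‖iteratedDeriv (2 * n) F 0‖)) := by
    refine Tendsto.congr' (EventuallyEq.symm hint) ?_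
    exact (ENNReal.continuous_ofReal.tendsto _).comp (aux_tendsto F hF (2 * n) (-n)).norm
  calc ∫⁻ ω, ENNReal.ofReal (|X ω| ^ (2 * n)) ∂μ
      = ∫⁻ ω, liminf (fun h : ℝ => ENNReal.ofReal (g h ω)) (𝓝[>] 0) ∂μ := by
        congr 1; ext ω; exact (hpt ω).liminf_eq.symm
    _ ≤ liminf (fun h : ℝ => ∫⁻ ω, ENNReal.ofReal (g h ω) ∂μ) (𝓝[>] 0) :=
        lintegral_liminf_le fun h => (hgm h).ennreal_ofReal
    _ = _ := hlim.liminf_eq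

/-- Let `X` be a real random variable on a probability space with characteristic function
`φ_X`, and `r, M > 0`. If some `F : ℂ → ℂ`, holomorphic on an open set containing the
closed disc of radius `r`, agrees with `φ_X` on `[-r, r]` and satisfies `|F| ≤ M` on the
disc, then `E[|X|^{2n}] ≤ 2n (2n)! M r^{−2n}` for all `n ≥ 1`; in particular `X` has
finite moments of all orders. -/
theorem stmt15 {Ω : Type*} [MeasurableSpace Ω] (μ : Measure Ω) [IsProbabilityMeasure μ]
    (X : Ω → ℝ) (hX : Measurable X) (r M : ℝ) (hr : 0 < r) (hM : 0 < M)
    (F : ℂ → ℂ) (U : Set ℂ) (hU : IsOpen U) (hUr : Metric.closedBall 0 r ⊆ U)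
    (hF : DifferentiableOn ℂ F U)
    (hFchar : ∀ t : ℝ, |t| ≤ r →
      F t = ∫ ω, Complex.exp (Complex.I * (t : ℂ) * (X ω : ℂ)) ∂μ)
    (hFM : ∀ z : ℂ, ‖z‖ ≤ r → ‖F z‖ ≤ M) :
    (∀ k : ℕ, Integrable (fun ω => |X ω| ^ k) μ) ∧
      ∀ n : ℕ, 1 ≤ n →
        (∫ ω, |X ω| ^ (2 * n) ∂μ) ≤
          2 * n * (Nat.factorial (2 * n)) * M / r ^ (2 * n) := by

  have hFan : AnalyticAt ℂ F 0 :=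
    hF.analyticAt (hU.mem_nhds (hUr (Metric.mem_closedBall_self hr.le)))
  have hmain := aux_main μ X hX r hr F hFan hFchar
  have hXm : ∀ k : ℕ, Measurable fun ω => |X ω| ^ k := fun k => hX.abs.pow_const k
  have heven : ∀ n : ℕ, Integrable (fun ω => |X ω| ^ (2 * n)) μ := by
    intro n
    refine ⟨(hXm _).aestronglyMeasurable, ?_⟩
    rw [hasFiniteIntegral_iff_ofReal (Filter.Eventually.of_forall fun ω => by positivity)]
    exact (hmain n).trans_lt ENNReal.ofReal_lt_top
  refine ⟨fun k => ?_, fun n hn => ?_⟩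
  · refine Integrable.mono' ((integrable_const (1 : ℝ)).add (heven k))
      (hXm k).aestronglyMeasurable (Filter.Eventually.of_forall fun ω => ?_)
    simp only [norm_pow, Real.norm_eq_abs, abs_abs, Pi.add_apply]
    rw [mul_comm 2 k, pow_mul]
    nlinarith [sq_nonneg (|X ω| ^ k - 1), sq_nonneg (|X ω| ^ k)]
  · have h1 : ∫ ω, |X ω| ^ (2 * n) ∂μ ≤ ‖iteratedDeriv (2 * n) F 0‖ := by
      rw [← ENNReal.ofReal_le_ofReal_iff (norm_nonneg _), ofReal_integral_eq_lintegral_ofReal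
        (heven n) (Filter.Eventually.of_forall fun ω => by positivity)]
      exact hmain n
    have h2 : ‖iteratedDeriv (2 * n) F 0‖ ≤ (2 * n).factorial * M / r ^ (2 * n) := by
      refine Complex.norm_iteratedDeriv_le_of_forall_mem_sphere_norm_le (2 * n) hr ?_ ?_
      · refine DifferentiableOn.diffContOnCl ?_
        rw [closure_ball _ hr.ne']
        exact hF.mono hUr
      · intro z hz
        exact hFM z (by simpa using (mem_sphere_zero_iff_norm.1 hz).le)
    refine h1.trans (h2.trans ?_)
    have hn' : (1 : ℝ) ≤ n := by exact_mod_cast hn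
    have hpos : 0 ≤ ((2 * n).factorial : ℝ) * M := by positivity
    gcongr
    nlinarith
end

section
/- Let X be a real random variable on a probability space with characteristic function φ_X, and let M > 0. Suppose there is a function F : ℂ → ℂ, holomorphic on an open set containing the closed disc { z : |z| ≤ 2 }, such that F(t) = φ_X(t) for all real t with |t| ≤ 2 and |F(z)| ≤ M for all |z| ≤ 2. Then e^{|X|} is integrable and E[e^{|X|}] ≤ e + 12M. -/
open MeasureTheory

open Filter Topology in
lemma aux_fwdDiff_bound (h : ℂ) (n : ℕ) : ∀ (G : ℂ → ℂ) (S : Set ℂ) (C : ℝ) (a : ℂ),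
    Convex ℝ S → (∀ z ∈ S, AnalyticAt ℂ G z) → (∀ z ∈ S, ‖iteratedDeriv n G z‖ ≤ C) →
    (∀ j : ℕ, j ≤ n → a + j * h ∈ S) → ‖(fwdDiff h)^[n] G a‖ ≤ C * ‖h‖ ^ n := by
  induction n with
  | zero =>
    intro G S C a _ _ hb ha
    simpa using hb a (by simpa using ha 0 le_rfl)
  | succ n ih =>
    intro G S C a hS hG hb ha
    rw [Function.iterate_succ_apply]
    have key := ih (fwdDiff h G) (S ∩ (fun z => z + h) ⁻¹' S) (C * ‖h‖) a
      (hS.inter (hS.translate_preimage_left h)) ?_ ?_ ?_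
    · calc _ ≤ _ := key
        _ = _ := by ring
    · rintro z ⟨hz, hz'⟩
      have h1 : AnalyticAt ℂ (fun z => G (z + h)) z :=
        (hG (z + h) hz').fun_comp_of_eq (by fun_prop) rfl
      exact h1.sub (hG z hz)
    · rintro z ⟨hz, hz'⟩
      have h1 : AnalyticAt ℂ (fun z => G (z + h)) z :=
        (hG (z + h) hz').fun_comp_of_eq (by fun_prop) rfl
      have e : iteratedDeriv n (fwdDiff h G) z
          = iteratedDeriv n G (z + h) - iteratedDeriv n G z := by
        have := iteratedDeriv_sub (n := n) h1.contDiffAt (hG z hz).contDiffAt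
        rw [iteratedDeriv_comp_add_const] at this
        exact this
      rw [e]
      have := hS.norm_image_sub_le_of_norm_deriv_le (f := iteratedDeriv n G) (C := C)
        (x := z) (y := z + h) ?_ ?_ hz hz'
      · simpa using this
      · intro x hx
        rw [iteratedDeriv_eq_iterate]
        exact ((hG x hx).iterated_deriv n).differentiableAt
      · intro x hx
        rw [← iteratedDeriv_succ]
        exact hb x hx
    · intro j hj
      refine ⟨ha j (by omega), ?_⟩
      have := ha (j + 1) (by omega)
      push_cast at this
      simp only [Set.mem_preimage]
      convert this using 1
      ring

lemma aux_fwdDiff_exp (h c : ℂ) (n : ℕ) : (fwdDiff h)^[n] (fun z => Complex.exp (Complex.I * z * c))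
    = fun z => (Complex.exp (Complex.I * h * c) - 1) ^ n * Complex.exp (Complex.I * z * c) := by
  induction n with
  | zero => simp
  | succ n ih =>
    rw [Function.iterate_succ_apply', ih]
    funext z
    simp only [fwdDiff]
    rw [show Complex.I * (z + h) * c = Complex.I * h * c + Complex.I * z * c by ring,
      Complex.exp_add]
    ring

lemma aux_pointwise (h x : ℝ) (k : ℕ) :
    ((‖Complex.exp (Complex.I * h * x) - 1‖ ^ (2 * k) : ℝ) : ℂ) =
      (-1) ^ k * (fwdDiff (h : ℂ))^[2 * k] (fun z => Complex.exp (Complex.I * z * x))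
        (-(k * h)) := by
  rw [aux_fwdDiff_exp]
  set w := Complex.exp (Complex.I * h * x) with hw
  have hw0 : w ≠ 0 := Complex.exp_ne_zero _
  have h1 : Complex.exp (Complex.I * (-(k * h)) * x) = (w⁻¹) ^ k := by
    rw [hw, ← Complex.exp_neg, ← Complex.exp_nat_mul]
    congr 1; ring
  have h2 : (starRingEnd ℂ) w = w⁻¹ := by
    rw [hw, ← Complex.exp_conj, ← Complex.exp_neg]
    congr 1; simp
  have h3 : ((‖w - 1‖ ^ 2 : ℝ) : ℂ) = -((w - 1) ^ 2 * w⁻¹) := by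
    push_cast
    rw [← Complex.mul_conj', map_sub, h2, map_one]
    field_simp
    ring
  simp only
  rw [h1, pow_mul, Complex.ofReal_pow, h3, pow_mul, ← mul_pow, ← mul_pow]
  congr 1; ring

lemma aux_diff_int {Ω : Type*} [MeasurableSpace Ω] (μ : Measure Ω) [IsProbabilityMeasure μ]
    (X : Ω → ℝ) (hX : Measurable X) (F : ℂ → ℂ)
    (hFchar : ∀ t : ℝ, |t| ≤ 2 →
      F t = ∫ ω, Complex.exp (Complex.I * (t : ℂ) * (X ω : ℂ)) ∂μ)
    (h : ℝ) (k : ℕ) (h0 : 0 ≤ h) (hk : k * h ≤ 1 / 2) :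
    ((∫ ω, ‖Complex.exp (Complex.I * h * X ω) - 1‖ ^ (2 * k) ∂μ : ℝ) : ℂ) =
      (-1) ^ k * (fwdDiff (h : ℂ))^[2 * k] F (-(k * h)) := by
  have hint : ∀ t : ℝ, Integrable (fun ω => Complex.exp (Complex.I * (t : ℂ) * (X ω : ℂ))) μ := by
    intro t
    refine Integrable.of_bound (C := 1) (by fun_prop) (ae_of_all _ fun ω => ?_)
    rw [show Complex.I * (t : ℂ) * (X ω : ℂ) = ((t * X ω : ℝ) : ℂ) * Complex.I by push_cast; ring,
      Complex.norm_exp_ofReal_mul_I]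
  have hpt : ∀ j : ℕ, (-((k : ℂ) * h) + j • (h : ℂ)) = ((-(k * h) + j * h : ℝ) : ℂ) := by
    intro j; push_cast; simp
  rw [← integral_complex_ofReal]
  simp_rw [aux_pointwise, fwdDiff_iter_eq_sum_shift, hpt]
  rw [integral_const_mul, integral_finsetSum]
  · congr 1
    refine Finset.sum_congr rfl fun j hj => ?_
    rw [hFchar]
    · simp only [zsmul_eq_mul]
      rw [integral_const_mul]
    · have : (j : ℝ) ≤ 2 * k := by
        have := Finset.mem_range.1 hj
        exact_mod_cast (by omega : j ≤ 2 * k)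
      rw [abs_le]
      constructor
      · nlinarith [mul_nonneg (Nat.cast_nonneg (α := ℝ) j) h0]
      · nlinarith [mul_le_mul_of_nonneg_right this h0]
  · intro j _
    exact (hint _).smul _

open Filter Topology in
lemma aux_moment {Ω : Type*} [MeasurableSpace Ω] (μ : Measure Ω) [IsProbabilityMeasure μ]
    (X : Ω → ℝ) (hX : Measurable X) (M : ℝ)
    (F : ℂ → ℂ) (U : Set ℂ) (hU : IsOpen U) (hUr : Metric.closedBall 0 2 ⊆ U)
    (hF : DifferentiableOn ℂ F U)
    (hFchar : ∀ t : ℝ, |t| ≤ 2 →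
      F t = ∫ ω, Complex.exp (Complex.I * (t : ℂ) * (X ω : ℂ)) ∂μ)
    (hFM : ∀ z : ℂ, ‖z‖ ≤ 2 → ‖F z‖ ≤ M) (k : ℕ) :
    ∫⁻ ω, ENNReal.ofReal (X ω ^ (2 * k)) ∂μ ≤
      ENNReal.ofReal ((2 * k).factorial * M / (3 / 2) ^ (2 * k)) := by
  set C : ℝ := (2 * k).factorial * M / (3 / 2) ^ (2 * k) with hC
  have hder : ∀ z ∈ Metric.closedBall (0 : ℂ) (1 / 2), ‖iteratedDeriv (2 * k) F z‖ ≤ C := by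
    intro z hz
    have hz' : ‖z‖ ≤ 1 / 2 := by simpa using hz
    have hsub : Metric.closedBall z (3 / 2) ⊆ Metric.closedBall 0 2 := by
      apply Metric.closedBall_subset_closedBall'
      rw [dist_zero_right]; linarith
    refine Complex.norm_iteratedDeriv_le_of_forall_mem_sphere_norm_le (2 * k) (by norm_num) ?_ ?_
    · apply DifferentiableOn.diffContOnCl
      rw [closure_ball _ (by norm_num)]
      exact hF.mono (hsub.trans hUr)
    · intro y hy
      apply hFM
      simpa using hsub (Metric.sphere_subset_closedBall hy)
  have hB : ∀ h : ℝ, 0 < h → k * h ≤ 1 / 2 →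
      ∫ ω, (‖Complex.exp (Complex.I * h * X ω) - 1‖ / h) ^ (2 * k) ∂μ ≤ C := by
    intro h h0 hk
    have h1 := aux_diff_int μ X hX F hFchar h k h0.le hk
    have h2 := aux_fwdDiff_bound (h : ℂ) (2 * k) F (Metric.closedBall 0 (1 / 2)) C (-(k * h))
      (convex_closedBall _ _) ?_ hder ?_
    · simp_rw [div_pow]
      rw [integral_div, div_le_iff₀ (by positivity)]
      have h3 := congrArg norm h1
      rw [norm_mul, norm_pow, norm_neg, norm_one, one_pow, one_mul, Complex.norm_real] at h3
      rw [← h3, Complex.norm_real, Real.norm_of_nonneg h0.le] at h2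
      exact (le_abs_self _).trans h2
    · intro z hz
      exact hF.analyticAt (hU.mem_nhds
        (hUr (Metric.closedBall_subset_closedBall (by norm_num) hz)))
    · intro j hj
      have hj' : (j : ℝ) ≤ 2 * k := by exact_mod_cast hj
      rw [show (-((k : ℂ) * h) + j * (h : ℂ)) = ((-(k * h) + j * h : ℝ) : ℂ) by push_cast; ring]
      rw [mem_closedBall_zero_iff, Complex.norm_real, Real.norm_eq_abs, abs_le]
      constructor
      · nlinarith [mul_nonneg (Nat.cast_nonneg (α := ℝ) j) h0.le]
      · nlinarith [mul_le_mul_of_nonneg_right hj' h0.le]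
  have hlim : ∀ x : ℝ, Tendsto (fun h : ℝ =>
      ENNReal.ofReal ((‖Complex.exp (Complex.I * h * x) - 1‖ / h) ^ (2 * k))) (𝓝[>] 0)
      (𝓝 (ENNReal.ofReal (x ^ (2 * k)))) := by
    intro x
    have hd : HasDerivAt (fun h : ℝ => Complex.exp (Complex.I * h * x)) (Complex.I * x) 0 := by
      have h1 : HasDerivAt (fun z : ℂ => Complex.exp (Complex.I * z * x)) (Complex.I * x)
          ((0 : ℝ) : ℂ) := by
        have := (((hasDerivAt_id ((0 : ℝ) : ℂ)).const_mul Complex.I).mul_const (x : ℂ)).cexp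
        simpa using this
      exact h1.comp_ofReal
    have hs := hd.tendsto_slope_zero_right.norm
    apply (ENNReal.continuous_ofReal.tendsto _).comp
    have hs2 := hs.pow (2 * k)
    have e : ‖Complex.I * (x : ℂ)‖ ^ (2 * k) = x ^ (2 * k) := by
      rw [norm_mul, Complex.norm_I, one_mul, Complex.norm_real, Real.norm_eq_abs]
      exact Even.pow_abs (even_two_mul k) x
    rw [e] at hs2
    refine hs2.congr' ?_
    filter_upwards [self_mem_nhdsWithin] with h hh
    have hh : 0 < h := hh
    congr 1
    simp [abs_of_pos hh]
    field_simp
  calc ∫⁻ ω, ENNReal.ofReal (X ω ^ (2 * k)) ∂μ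
      = ∫⁻ ω, liminf (fun h : ℝ => ENNReal.ofReal
          ((‖Complex.exp (Complex.I * h * X ω) - 1‖ / h) ^ (2 * k))) (𝓝[>] 0) ∂μ := by
        refine lintegral_congr fun ω => ?_
        rw [(hlim (X ω)).liminf_eq]
    _ ≤ liminf (fun h : ℝ => ∫⁻ ω, ENNReal.ofReal
          ((‖Complex.exp (Complex.I * h * X ω) - 1‖ / h) ^ (2 * k)) ∂μ) (𝓝[>] 0) :=
        lintegral_liminf_le fun h => by fun_prop
    _ ≤ liminf (fun _ : ℝ => ENNReal.ofReal C) (𝓝[>] 0) := by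
        refine liminf_le_liminf ?_
        have hsm : ∀ᶠ h : ℝ in 𝓝[>] 0, k * h ≤ 1 / 2 := by
          have : Tendsto (fun h : ℝ => k * h) (𝓝[>] 0) (𝓝 (k * 0)) :=
            ((continuous_const.mul continuous_id).tendsto 0).mono_left nhdsWithin_le_nhds
          rw [mul_zero] at this
          exact this.eventually (eventually_le_nhds (by norm_num))
        filter_upwards [self_mem_nhdsWithin, hsm] with h hh hk
        have hh : 0 < h := hh
        rw [← ofReal_integral_eq_lintegral_ofReal]
        · exact ENNReal.ofReal_le_ofReal (hB h hh hk)
        · refine Integrable.of_bound (C := (2 / h) ^ (2 * k))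
            (by fun_prop) (ae_of_all _ fun ω => ?_)
          rw [Real.norm_of_nonneg (by positivity)]
          gcongr
          refine (norm_sub_le _ _).trans ?_
          rw [show Complex.I * (h : ℂ) * (X ω : ℂ) = ((h * X ω : ℝ) : ℂ) * Complex.I by
            push_cast; ring, Complex.norm_exp_ofReal_mul_I]
          norm_num
        · exact ae_of_all _ fun ω => by positivity
    _ = ENNReal.ofReal C := by simp

/-- Let `X` be a real random variable on a probability space with characteristic function
`φ_X`, and `M > 0`. If some `F : ℂ → ℂ`, holomorphic on an open set containing the closed
disc of radius `2`, agrees with `φ_X` on `[-2, 2]` and satisfies `|F| ≤ M` on that disc,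
then `e^{|X|}` is integrable and `E[e^{|X|}] ≤ e + 12 M`. -/
theorem stmt16 {Ω : Type*} [MeasurableSpace Ω] (μ : Measure Ω) [IsProbabilityMeasure μ]
    (X : Ω → ℝ) (hX : Measurable X) (M : ℝ) (hM : 0 < M)
    (F : ℂ → ℂ) (U : Set ℂ) (hU : IsOpen U) (hUr : Metric.closedBall 0 2 ⊆ U)
    (hF : DifferentiableOn ℂ F U)
    (hFchar : ∀ t : ℝ, |t| ≤ 2 →
      F t = ∫ ω, Complex.exp (Complex.I * (t : ℂ) * (X ω : ℂ)) ∂μ)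
    (hFM : ∀ z : ℂ, ‖z‖ ≤ 2 → ‖F z‖ ≤ M) :
    Integrable (fun ω => Real.exp |X ω|) μ ∧
      (∫ ω, Real.exp |X ω| ∂μ) ≤ Real.exp 1 + 12 * M := by
  have hmeas : Measurable (fun ω => Real.exp |X ω|) := by fun_prop
  have hsumR : HasSum (fun k : ℕ => 2 * M * (4 / 9 : ℝ) ^ k) (18 / 5 * M) := by
    have := (hasSum_geometric_of_lt_one (r := (4 / 9 : ℝ)) (by norm_num) (by norm_num)).mul_left
      (2 * M)
    rwa [show 2 * M * (1 - 4 / 9 : ℝ)⁻¹ = 18 / 5 * M by ring] at this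
  have hle : ∫⁻ ω, ENNReal.ofReal (Real.exp |X ω|) ∂μ ≤ ENNReal.ofReal (18 / 5 * M) := by
    calc ∫⁻ ω, ENNReal.ofReal (Real.exp |X ω|) ∂μ
        ≤ ∫⁻ ω, ∑' k : ℕ, ENNReal.ofReal (2 / (2 * k).factorial) *
            ENNReal.ofReal (X ω ^ (2 * k)) ∂μ := by
          refine lintegral_mono fun ω => ?_
          have hs := (Real.hasSum_cosh (X ω)).mul_left 2
          have e : ∀ k : ℕ, ENNReal.ofReal (2 / (2 * k).factorial) *
            ENNReal.ofReal (X ω ^ (2 * k)) =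
              ENNReal.ofReal (2 * (X ω ^ (2 * k) / (2 * k).factorial)) := by
            intro k
            rw [← ENNReal.ofReal_mul (by positivity)]
            congr 1; ring
          simp_rw [e]
          rw [← ENNReal.ofReal_tsum_of_nonneg _ hs.summable, hs.tsum_eq]
          · apply ENNReal.ofReal_le_ofReal
            rw [← Real.cosh_abs, Real.cosh_eq]
            linarith [Real.exp_pos (-|X ω|)]
          · intro k
            have := (even_two_mul k).pow_nonneg (X ω)
            positivity
      _ = ∑' k : ℕ, ENNReal.ofReal (2 / (2 * k).factorial) *
            ∫⁻ ω, ENNReal.ofReal (X ω ^ (2 * k)) ∂μ := by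
          rw [lintegral_tsum (fun k => by fun_prop)]
          congr 1; funext k
          rw [lintegral_const_mul _ (by fun_prop)]
      _ ≤ ∑' k : ℕ, ENNReal.ofReal (2 * M * (4 / 9 : ℝ) ^ k) := by
          refine ENNReal.tsum_le_tsum fun k => ?_
          refine (mul_le_mul_right (aux_moment μ X hX M F U hU hUr hF hFchar hFM k) _).trans ?_
          rw [← ENNReal.ofReal_mul (by positivity)]
          apply le_of_eq
          congr 1
          rw [pow_mul, show ((4 : ℝ) / 9) = ((3 / 2 : ℝ) ^ 2)⁻¹ by norm_num, inv_pow]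
          have : ((2 * k).factorial : ℝ) ≠ 0 := by positivity
          field_simp
      _ = ENNReal.ofReal (18 / 5 * M) := by
          rw [← ENNReal.ofReal_tsum_of_nonneg (fun k => by positivity) hsumR.summable,
            hsumR.tsum_eq]
  have hint : Integrable (fun ω => Real.exp |X ω|) μ := by
    refine ⟨hmeas.aestronglyMeasurable, ?_⟩
    rw [hasFiniteIntegral_iff_ofReal (ae_of_all _ fun ω => (Real.exp_pos _).le)]
    exact hle.trans_lt ENNReal.ofReal_lt_top
  refine ⟨hint, ?_⟩
  rw [integral_eq_lintegral_of_nonneg_ae (ae_of_all _ fun ω => (Real.exp_pos _).le)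
    hmeas.aestronglyMeasurable]
  have := ENNReal.toReal_mono ENNReal.ofReal_ne_top hle
  rw [ENNReal.toReal_ofReal (by positivity)] at this
  linarith [Real.exp_pos 1]
end

section
/- Let X be a real random variable, and let c > 0, α > 0, q > 1, with Hölder conjugate p = q/(q−1). Suppose that for all t ≥ 0 both E[e^{tX}] ≤ c·e^{α t^q/q} and E[e^{−tX}] ≤ c·e^{α t^q/q}. Then for every t ≥ 0: P(|X| ≥ t) ≤ 2c·exp( −t^p / (p·α^{p/q}) ). -/
open MeasureTheory

/-- Let `X` be a real random variable, `c > 0`, `α > 0`, `q > 1` with Hölder conjugate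
`p = q/(q−1)`. If `E[e^{tX}] ≤ c e^{α t^q / q}` and `E[e^{−tX}] ≤ c e^{α t^q / q}` for
all `t ≥ 0` (in particular `e^{±tX}` is integrable), then for every `t ≥ 0`:
`P(|X| ≥ t) ≤ 2c · exp(−t^p / (p α^{p/q}))`. -/
theorem stmt17 {Ω : Type*} [MeasurableSpace Ω] (μ : Measure Ω) [IsProbabilityMeasure μ]
    (X : Ω → ℝ) (hX : Measurable X) (c α q : ℝ) (hc : 0 < c) (hα : 0 < α) (hq : 1 < q)
    (hmgf : ∀ t : ℝ, 0 ≤ t →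
      (Integrable (fun ω => Real.exp (t * X ω)) μ ∧
        (∫ ω, Real.exp (t * X ω) ∂μ) ≤ c * Real.exp (α * t ^ q / q)) ∧
      (Integrable (fun ω => Real.exp (-t * X ω)) μ ∧
        (∫ ω, Real.exp (-t * X ω) ∂μ) ≤ c * Real.exp (α * t ^ q / q))) :
    ∀ t : ℝ, 0 ≤ t →
      μ {ω | t ≤ |X ω|} ≤
        ENNReal.ofReal (2 * c *
          Real.exp (-(t ^ (q / (q - 1))) /
            ((q / (q - 1)) * α ^ ((q / (q - 1)) / q)))) := by
  intro t ht
  have hq1 : 0 < q - 1 := by linarith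
  have hq0 : 0 < q := by linarith
  obtain ⟨s, hs⟩ : ∃ s : ℝ, s = (t / α) ^ (1 / (q - 1)) := ⟨_, rfl⟩
  have hta : 0 ≤ t / α := by positivity
  have hs0 : 0 ≤ s := by rw [hs]; positivity
  have h1 : α * s ^ q = s * t := by
    have : s ^ q = s * (t / α) := by
      have h2 : s ^ (q - 1) = t / α := by
        rw [hs, ← Real.rpow_mul hta, one_div_mul_cancel hq1.ne', Real.rpow_one]
      rw [← h2, mul_comm, ← Real.rpow_add_one' hs0 (by linarith)]
      congr 1; ring
    rw [this]; field_simp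
  have h3 : t ^ (q / (q - 1)) = s * t * α ^ ((q / (q - 1)) / q) := by
    have e1 : q / (q - 1) / q = 1 / (q - 1) := by field_simp
    have e2 : q / (q - 1) = 1 / (q - 1) + 1 := by field_simp; ring
    have e3 : 1 / (q - 1) + 1 ≠ 0 := by positivity
    rw [e1, e2, Real.rpow_add_one' ht e3, hs, Real.div_rpow ht hα.le]
    have : 0 < α ^ (1 / (q - 1)) := by positivity
    field_simp
  have h4 : -(t ^ (q / (q - 1))) / ((q / (q - 1)) * α ^ ((q / (q - 1)) / q))
      = -s * t + α * s ^ q / q := by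
    rw [h3, h1]
    have : 0 < α ^ ((q / (q - 1)) / q) := by positivity
    generalize α ^ ((q / (q - 1)) / q) = A at *
    field_simp
    ring
  rw [h4]
  obtain ⟨⟨i1, b1⟩, ⟨i2, b2⟩⟩ := hmgf s hs0
  have u1 := ProbabilityTheory.measure_ge_le_exp_mul_mgf t hs0 i1
  have u2 := ProbabilityTheory.measure_le_le_exp_mul_mgf (-t) (neg_nonpos.mpr hs0) i2
  have v1 := u1.trans (mul_le_mul_of_nonneg_left b1 (Real.exp_pos _).le)
  have v2 := u2.trans (mul_le_mul_of_nonneg_left b2 (Real.exp_pos _).le)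
  have hsub : {ω | t ≤ |X ω|} ⊆ {ω | t ≤ X ω} ∪ {ω | X ω ≤ -t} := by
    intro ω h
    rw [Set.mem_setOf_eq] at h
    rcases le_abs.mp h with h | h
    · exact Or.inl h
    · exact Or.inr (by simp only [Set.mem_setOf_eq]; linarith)
  have w : μ.real {ω | t ≤ |X ω|} ≤ μ.real {ω | t ≤ X ω} + μ.real {ω | X ω ≤ -t} :=
    (measureReal_mono hsub).trans (measureReal_union_le _ _)
  rw [← ofReal_measureReal]
  apply ENNReal.ofReal_le_ofReal
  rw [Real.exp_add]
  rw [show - -s * -t = -s * t by ring] at v2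
  linarith
end

section
/- Let (f_n) be a sequence of entire functions ℂ → ℂ that is locally uniformly bounded (for every R > 0 there is M > 0 with |f_n(z)| ≤ M for all n and all |z| ≤ R) and such that the sequence (f_n(x)) converges for every real x ∈ ℝ. Then there exists an entire function f such that f_n → f uniformly on every compact subset of ℂ. -/
open Filter Topology Metric Set in
theorem aux_equicont (f : ℕ → ℂ → ℂ) (hdiff : ∀ n, Differentiable ℂ (f n))
    (hbd : ∀ R : ℝ, 0 < R → ∃ M : ℝ, 0 < M ∧ ∀ n, ∀ z : ℂ, ‖z‖ ≤ R → ‖f n z‖ ≤ M) :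
    Equicontinuous f := by
  intro z₀
  obtain ⟨M, hM, hfM⟩ := hbd (‖z₀‖ + 1) (by positivity)
  refine Metric.equicontinuousAt_of_continuity_modulus (fun z => (2 * M) / 1 * dist z z₀) ?_ f ?_
  · have : Continuous fun z : ℂ => (2 * M) / 1 * dist z z₀ := by fun_prop
    simpa using this.tendsto z₀
  · filter_upwards [ball_mem_nhds z₀ one_pos] with z hz n
    rw [dist_comm]
    refine Complex.dist_le_div_mul_dist_of_mapsTo_ball (hdiff n).differentiableOn ?_ hz
    intro w hw
    rw [mem_ball, dist_eq_norm] at hw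
    rw [mem_closedBall, dist_eq_norm]
    have h1 : ‖w‖ ≤ ‖z₀‖ + 1 := by
      have := norm_add_le (w - z₀) z₀
      rw [sub_add_cancel] at this
      linarith
    have h2 := hfM n w h1
    have h3 := hfM n z₀ (by linarith)
    linarith [norm_sub_le (f n w) (f n z₀)]

open Filter Topology Metric Set in
theorem aux_unif (f : ℕ → ℂ → ℂ) (hf : Equicontinuous f) (l : Filter ℕ) (g : ℂ → ℂ)
    (h : ∀ z, Tendsto (fun n => f n z) l (𝓝 (g z))) (K : Set ℂ) (hK : IsCompact K) :
    TendstoUniformlyOn f g l K := by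
  have h1 := (EquicontinuousOn.tendsto_uniformOnFun_iff_pi (F := f) (𝔖 := {K | IsCompact K})
    (fun K hK => hK) (by
      rw [eq_univ_iff_forall]
      exact fun z => ⟨{z}, isCompact_singleton, rfl⟩)
    (fun K _ => hf.equicontinuousOn K) l g).2 (tendsto_pi_nhds.2 h)
  exact (UniformOnFun.tendsto_iff_tendstoUniformlyOn.1 h1) K hK

open Filter Topology Metric Set in
theorem aux_entire (f : ℕ → ℂ → ℂ) (hdiff : ∀ n, Differentiable ℂ (f n))
    (hf : Equicontinuous f) (l : Filter ℕ) [l.NeBot] (g : ℂ → ℂ)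
    (h : ∀ z, Tendsto (fun n => f n z) l (𝓝 (g z))) : Differentiable ℂ g := by
  have : TendstoLocallyUniformlyOn f g l univ :=
    (tendstoLocallyUniformlyOn_iff_forall_isCompact isOpen_univ).2
      fun K _ hK => aux_unif f hf l g h K hK
  exact differentiableOn_univ.1 (this.differentiableOn
    (Eventually.of_forall fun n => (hdiff n).differentiableOn) isOpen_univ)

/-- Let `(f_n)` be a sequence of entire functions that is locally uniformly bounded and
such that `(f_n(x))` converges for every real `x`. Then there is an entire function `f`
with `f_n → f` uniformly on every compact subset of `ℂ`. -/
theorem stmt19 (f : ℕ → ℂ → ℂ) (hdiff : ∀ n, Differentiable ℂ (f n))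
    (hbd : ∀ R : ℝ, 0 < R → ∃ M : ℝ, 0 < M ∧ ∀ n, ∀ z : ℂ, ‖z‖ ≤ R → ‖f n z‖ ≤ M)
    (hconv : ∀ x : ℝ, ∃ l : ℂ,
      Filter.Tendsto (fun n => f n (x : ℂ)) Filter.atTop (nhds l)) :
    ∃ g : ℂ → ℂ, Differentiable ℂ g ∧
      ∀ K : Set ℂ, IsCompact K →
        TendstoUniformlyOn (fun n => f n) g Filter.atTop K := by
  open Filter Topology Metric Set in
  have heq := aux_equicont f hdiff hbd
  -- pointwise limits along ultrafilters
  have hU : ∀ U : Ultrafilter ℕ, ∃ g : ℂ → ℂ,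
      ∀ z, Filter.Tendsto (fun n => f n z) U (nhds (g z)) := by
    intro U
    have : ∀ z, ∃ w, Filter.Tendsto (fun n => f n z) U (nhds w) := by
      intro z
      obtain ⟨M, hM, hfM⟩ := hbd (‖z‖ + 1) (by positivity)
      obtain ⟨w, -, hw⟩ := (isCompact_closedBall (0 : ℂ) M).ultrafilter_le_nhds
        (U.map fun n => f n z) (by
          rw [Filter.le_principal_iff, Ultrafilter.coe_map, Filter.mem_map]
          refine Filter.univ_mem' fun n => ?_
          simpa using hfM n z (by linarith))
      exact ⟨w, hw⟩
    choose g hg using this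
    exact ⟨g, hg⟩
  choose G hG using hU
  have hGd : ∀ U, Differentiable ℂ (G U) := fun U => aux_entire f hdiff heq U (G U) (hG U)
  choose l hl using hconv
  have hGl : ∀ U : Ultrafilter ℕ, (U : Filter ℕ) ≤ Filter.atTop → ∀ x : ℝ, G U x = l x :=
    fun U h x => tendsto_nhds_unique (hG U x) ((hl x).mono_left h)
  let V : Ultrafilter ℕ := Ultrafilter.of Filter.atTop
  have hV : (V : Filter ℕ) ≤ Filter.atTop := Ultrafilter.of_le _
  have hall : ∀ U : Ultrafilter ℕ, (U : Filter ℕ) ≤ Filter.atTop → G U = G V := by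
    intro U h
    refine AnalyticOnNhd.eq_of_frequently_eq (z₀ := ((0 : ℝ) : ℂ))
      (fun z _ => (hGd U).analyticAt z) (fun z _ => (hGd V).analyticAt z) ?_
    have ht : Filter.Tendsto (fun x : ℝ => (x : ℂ)) (nhdsWithin 0 {0}ᶜ)
        (nhdsWithin ((0 : ℝ) : ℂ) {((0 : ℝ) : ℂ)}ᶜ) := by
      refine (Complex.continuous_ofReal.continuousAt (x := 0)).continuousWithinAt.tendsto_nhdsWithin ?_
      intro x hx
      simpa using hx
    refine ht.frequently (Filter.Eventually.frequently (Filter.Eventually.of_forall fun x => ?_))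
    rw [hGl U h, hGl V hV]
  refine ⟨G V, hGd V, fun K hK => aux_unif f heq _ _ (fun z => ?_) K hK⟩
  rw [Filter.tendsto_iff_ultrafilter]
  intro U h
  rw [← hall U h]
  exact hG U z
end
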